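/- arXiv:2303.02793 — 3 statements merged into one kernel-verified Lean document; each statement's English description precedes it below -/
import Mathlib

section
/- For every integer n ≥ 1, the number a(n) satisfies 6·a(n) = n^3 + 39n^2 + 260n + 402. -/
open Finset

/-- The integers `±2 ^ j` with `j < K`. -/
def signedPowersOfTwo (K : ℕ) : Finset ℤ :=
  (range K).image (fun j => 2 ^ j) ∪ (range K).image (fun j => -2 ^ j)

/-- The multisets of `m` signed powers of two `±2 ^ j`, `j < K`, with sum `c`. -/
def signedPowerSums (K m : ℕ) (c : ℤ) : Finset (Multiset ℤ) :=
  (((signedPowersOfTwo K).sym m).image (fun s : Sym ℤ m => (s : Multiset ℤ))).filter (fun s => s.sum = c)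

/-- The number of multisets in `signedPowerSums K m c`, computed by removing the `p` copies of `1`
and the `q` copies of `-1` and halving the other elements. -/
def signedPowerCount : ℕ → ℕ → ℤ → ℕ
  | 0, m, c => if m = 0 ∧ c = 0 then 1 else 0
  | K + 1, m, c => ∑ p ∈ range (m + 1), ∑ q ∈ range (m + 1 - p),
      if (2 : ℤ) ∣ c - p + q then signedPowerCount K (m - p - q) ((c - p + q) / 2) else 0

lemma mem_signedPowersOfTwo {K : ℕ} {v : ℤ} :
    v ∈ signedPowersOfTwo K ↔ ∃ j < K, v = 2 ^ j ∨ v = -2 ^ j := by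
  simp only [signedPowersOfTwo, mem_union, mem_image, mem_range]
  grind

lemma mem_signedPowerSums {K m : ℕ} {c : ℤ} {s : Multiset ℤ} :
    s ∈ signedPowerSums K m c ↔
      s.card = m ∧ (∀ v ∈ s, v ∈ signedPowersOfTwo K) ∧ s.sum = c := by
  simp only [signedPowerSums, mem_filter, mem_image, mem_sym_iff]
  constructor
  · rintro ⟨⟨t, ht, rfl⟩, hs⟩
    exact ⟨t.2, ht, hs⟩
  · rintro ⟨h1, h2, h3⟩
    exact ⟨⟨⟨s, h1⟩, h2, rfl⟩, h3⟩

lemma mem_signedPowersOfTwo_succ {K : ℕ} {v : ℤ} :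
    v ∈ signedPowersOfTwo (K + 1) ↔
      v = 1 ∨ v = -1 ∨ ∃ w ∈ signedPowersOfTwo K, v = 2 * w := by
  simp only [mem_signedPowersOfTwo]
  constructor
  · rintro ⟨_ | j, hj, h⟩
    · simpa [or_assoc] using Or.imp_right Or.inl h
    · right; right
      rcases h with rfl | rfl
      · exact ⟨2 ^ j, ⟨j, by omega, .inl rfl⟩, by ring⟩
      · exact ⟨-2 ^ j, ⟨j, by omega, .inr rfl⟩, by ring⟩
  · rintro (rfl | rfl | ⟨w, ⟨j, hj, h⟩, rfl⟩)
    · exact ⟨0, by omega, by simp⟩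
    · exact ⟨0, by omega, by simp⟩
    · refine ⟨j + 1, by omega, ?_⟩
      rcases h with rfl | rfl
      · left; ring
      · right; ring

/-- The multiset with `p` copies of `1`, `q` copies of `-1` and the doubles of the elements
of `t`. -/
def doubleAddUnits (p q : ℕ) (t : Multiset ℤ) : Multiset ℤ :=
  Multiset.replicate p 1 + Multiset.replicate q (-1) + t.map (2 * ·)

lemma doubleAddUnits_injective (p q : ℕ) : Function.Injective (doubleAddUnits p q) := by
  intro s t h
  exact Multiset.map_injective (mul_right_injective₀ (two_ne_zero : (2 : ℤ) ≠ 0))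
    (add_left_cancel h)

lemma count_one_doubleAddUnits (p q : ℕ) (t : Multiset ℤ) :
    (doubleAddUnits p q t).count 1 = p := by
  have h : (1 : ℤ) ∉ t.map (2 * ·) := by
    simp only [Multiset.mem_map, not_exists, not_and]
    omega
  rw [doubleAddUnits, Multiset.count_add, Multiset.count_add, Multiset.count_eq_zero.2 h]
  simp [Multiset.count_replicate]

lemma count_neg_one_doubleAddUnits (p q : ℕ) (t : Multiset ℤ) :
    (doubleAddUnits p q t).count (-1) = q := by
  have h : (-1 : ℤ) ∉ t.map (2 * ·) := by
    simp only [Multiset.mem_map, not_exists, not_and]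
    omega
  rw [doubleAddUnits, Multiset.count_add, Multiset.count_add, Multiset.count_eq_zero.2 h]
  simp [Multiset.count_replicate]

lemma card_doubleAddUnits (p q : ℕ) (t : Multiset ℤ) :
    (doubleAddUnits p q t).card = p + q + t.card := by
  simp [doubleAddUnits]

lemma sum_doubleAddUnits (p q : ℕ) (t : Multiset ℤ) :
    (doubleAddUnits p q t).sum = p - q + 2 * t.sum := by
  have h : (t.map (2 * ·)).sum = 2 * t.sum := by
    simpa using Multiset.sum_map_mul_left (s := t) (f := id) (a := (2 : ℤ))
  simp only [doubleAddUnits, Multiset.sum_add, Multiset.sum_replicate, h]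
  simp [sub_eq_add_neg]

lemma forall_mem_doubleAddUnits {K : ℕ} (p q : ℕ) (t : Multiset ℤ) :
    (∀ v ∈ doubleAddUnits p q t, v ∈ signedPowersOfTwo (K + 1)) ↔
      ∀ w ∈ t, w ∈ signedPowersOfTwo K := by
  simp only [doubleAddUnits, Multiset.mem_add, Multiset.mem_replicate, Multiset.mem_map,
    mem_signedPowersOfTwo_succ]
  constructor
  · intro h w hw
    obtain h | h | ⟨u, hu, h⟩ := h (2 * w) (.inr ⟨w, hw, rfl⟩)
    · omega
    · omega
    · obtain rfl : w = u := by omega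
      exact hu
  · rintro h v ((⟨-, rfl⟩ | ⟨-, rfl⟩) | ⟨w, hw, rfl⟩)
    · exact .inl rfl
    · exact .inr (.inl rfl)
    · exact .inr (.inr ⟨w, h w hw, rfl⟩)

lemma exists_eq_doubleAddUnits {K : ℕ} {s : Multiset ℤ}
    (hs : ∀ v ∈ s, v ∈ signedPowersOfTwo (K + 1)) :
    ∃ t, s = doubleAddUnits (s.count 1) (s.count (-1)) t := by
  induction s using Multiset.induction_on with
  | empty => exact ⟨0, by simp [doubleAddUnits]⟩
  | cons v s ih =>
    obtain ⟨t, ht⟩ := ih fun w hw => hs w (Multiset.mem_cons_of_mem hw)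
    generalize s.count 1 = p at ht
    generalize s.count (-1) = q at ht
    suffices ∃ p q t, v ::ₘ s = doubleAddUnits p q t by
      obtain ⟨p', q', t', h⟩ := this
      exact ⟨t', by rw [h, count_one_doubleAddUnits, count_neg_one_doubleAddUnits]⟩
    obtain rfl | rfl | ⟨w, -, rfl⟩ :=
      mem_signedPowersOfTwo_succ.1 (hs v (Multiset.mem_cons_self v s))
    · exact ⟨p + 1, q, t, by simp [ht, doubleAddUnits, Multiset.replicate_succ]⟩
    · exact ⟨p, q + 1, t, by simp [ht, doubleAddUnits, Multiset.replicate_succ]⟩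
    · exact ⟨p, q, w ::ₘ t, by simp [ht, doubleAddUnits]⟩

lemma card_filter_count_signedPowerSums (K m p q : ℕ) (c : ℤ) (h : p + q ≤ m) :
    #{s ∈ signedPowerSums (K + 1) m c | s.count 1 = p ∧ s.count (-1) = q} =
      if (2 : ℤ) ∣ c - p + q then #(signedPowerSums K (m - p - q) ((c - p + q) / 2)) else 0 := by
  split_ifs with hc
  · rw [← card_image_of_injective (signedPowerSums K (m - p - q) ((c - p + q) / 2))
      (doubleAddUnits_injective p q)]
    congr 1
    ext s
    simp only [mem_filter, mem_image, mem_signedPowerSums]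
    constructor
    · rintro ⟨⟨h1, h2, h3⟩, rfl, rfl⟩
      obtain ⟨t, ht⟩ := exists_eq_doubleAddUnits h2
      generalize s.count 1 = p at *
      generalize s.count (-1) = q at *
      subst ht
      rw [card_doubleAddUnits] at h1
      rw [sum_doubleAddUnits] at h3
      exact ⟨t, ⟨by omega, (forall_mem_doubleAddUnits p q t).1 h2, by omega⟩, rfl⟩
    · rintro ⟨t, ⟨h1, h2, h3⟩, rfl⟩
      refine ⟨⟨?_, (forall_mem_doubleAddUnits p q t).2 h2, ?_⟩, count_one_doubleAddUnits p q t,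
        count_neg_one_doubleAddUnits p q t⟩
      · rw [card_doubleAddUnits]; omega
      · rw [sum_doubleAddUnits]; omega
  · rw [card_eq_zero, filter_eq_empty_iff]
    rintro s hs ⟨rfl, rfl⟩
    obtain ⟨-, h2, h3⟩ := mem_signedPowerSums.1 hs
    obtain ⟨t, ht⟩ := exists_eq_doubleAddUnits h2
    rw [ht, sum_doubleAddUnits] at h3
    omega

lemma count_one_add_count_neg_one_le (s : Multiset ℤ) :
    s.count 1 + s.count (-1) ≤ s.card := by
  induction s using Multiset.induction_on with
  | empty => simp
  | cons v s ih =>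
    simp only [Multiset.count_cons, Multiset.card_cons]
    split_ifs <;> omega

lemma card_signedPowerSums (K m : ℕ) (c : ℤ) :
    #(signedPowerSums K m c) = signedPowerCount K m c := by
  induction K generalizing m c with
  | zero =>
    rw [signedPowerCount]
    split_ifs with h
    · obtain ⟨rfl, rfl⟩ := h
      rw [card_eq_one]
      refine ⟨0, ?_⟩
      ext s
      rw [mem_signedPowerSums, mem_singleton, Multiset.card_eq_zero]
      exact ⟨fun h => h.1, by rintro rfl; simp⟩
    · rw [card_eq_zero, eq_empty_iff_forall_notMem]
      intro s hs
      obtain ⟨h1, h2, h3⟩ := mem_signedPowerSums.1 hs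
      obtain rfl : s = 0 := Multiset.eq_zero_of_forall_notMem fun v hv => by
        simpa [signedPowersOfTwo] using h2 v hv
      exact h ⟨by simpa using h1.symm, by simpa using h3.symm⟩
  | succ K ih =>
    rw [signedPowerCount, card_eq_sum_card_fiberwise (f := fun s => s.count 1)
      (t := range (m + 1))]
    · refine sum_congr rfl fun p hp => ?_
      rw [card_eq_sum_card_fiberwise (f := fun s => s.count (-1)) (t := range (m + 1 - p))]
      · refine sum_congr rfl fun q hq => ?_
        rw [mem_range] at hp hq
        rw [filter_filter, card_filter_count_signedPowerSums _ _ _ _ _ (by omega), ih]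
      · intro s hs
        obtain ⟨hs, hp⟩ := mem_filter.1 (mem_coe.1 hs)
        have h1 := (mem_signedPowerSums.1 hs).1
        have h2 := count_one_add_count_neg_one_le s
        simp only [coe_range, Set.mem_Iio]
        omega
    · intro s hs
      have h1 := (mem_signedPowerSums.1 (mem_coe.1 hs)).1
      have h2 := count_one_add_count_neg_one_le s
      simp only [coe_range, Set.mem_Iio]
      omega

/-- The fourth forward difference of `signedPowerCount K m c` in `K`. -/
def signedPowerCountDiff (K m : ℕ) (c : ℤ) : ℤ :=
  signedPowerCount (K + 4) m c - 4 * signedPowerCount (K + 3) m c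
    + 6 * signedPowerCount (K + 2) m c - 4 * signedPowerCount (K + 1) m c
    + signedPowerCount K m c

lemma signedPowerCountDiff_succ (K m : ℕ) (c : ℤ) :
    signedPowerCountDiff (K + 1) m c = ∑ p ∈ range (m + 1), ∑ q ∈ range (m + 1 - p),
      if (2 : ℤ) ∣ c - p + q then signedPowerCountDiff K (m - p - q) ((c - p + q) / 2) else 0 := by
  have h (L : ℕ) : (signedPowerCount (L + 1) m c : ℤ) =
      ∑ p ∈ range (m + 1), ∑ q ∈ range (m + 1 - p), if (2 : ℤ) ∣ c - p + q then
        (signedPowerCount L (m - p - q) ((c - p + q) / 2) : ℤ) else 0 := by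
    rw [signedPowerCount]
    push_cast
    rfl
  rw [signedPowerCountDiff, show K + 1 + 4 = (K + 4) + 1 by ring,
    show K + 1 + 3 = (K + 3) + 1 by ring, show K + 1 + 2 = (K + 2) + 1 by ring, h, h, h, h, h]
  simp only [mul_sum, ← sum_sub_distrib, ← sum_add_distrib]
  refine sum_congr rfl fun p _ => sum_congr rfl fun q _ => ?_
  split_ifs
  · rfl
  · simp

lemma signedPowerCountDiff_five :
    ∀ m ∈ range 7, ∀ d ∈ range 13, m + ((d : ℤ) - 6).natAbs ≤ 6 →
      signedPowerCountDiff 5 m ((d : ℤ) - 6) = 0 := by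
  decide +kernel

lemma signedPowerCountDiff_eq_zero (K m : ℕ) (c : ℤ) (h : m + c.natAbs ≤ 6) :
    signedPowerCountDiff (K + 5) m c = 0 := by
  induction K generalizing m c with
  | zero =>
    have := signedPowerCountDiff_five m (mem_range.2 (by omega)) (c + 6).toNat
      (mem_range.2 (by omega))
    rw [show (((c + 6).toNat : ℕ) : ℤ) - 6 = c by omega] at this
    exact this h
  | succ K ih =>
    rw [show K + 1 + 5 = (K + 5) + 1 by ring, signedPowerCountDiff_succ]
    refine sum_eq_zero fun p hp => sum_eq_zero fun q hq => ?_
    rw [mem_range] at hp hq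
    split_ifs with hc
    · exact ih _ _ (by omega)
    · rfl

/-- The number of multisets in `signedPowerSums (K + 1) 6 0` that do not contain `-1`. -/
def zeroSumCount (K : ℕ) : ℤ :=
  signedPowerCount K 6 0 + signedPowerCount K 4 (-1) + signedPowerCount K 2 (-2)
    + signedPowerCount K 0 (-3)

lemma zeroSumCount_add_four (K : ℕ) :
    zeroSumCount (K + 9) = 4 * zeroSumCount (K + 8) - 6 * zeroSumCount (K + 7)
      + 4 * zeroSumCount (K + 6) - zeroSumCount (K + 5) := by
  have h1 := signedPowerCountDiff_eq_zero K 6 0 (by decide)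
  have h2 := signedPowerCountDiff_eq_zero K 4 (-1) (by decide)
  have h3 := signedPowerCountDiff_eq_zero K 2 (-2) (by decide)
  have h4 := signedPowerCountDiff_eq_zero K 0 (-3) (by decide)
  simp only [signedPowerCountDiff, Nat.add_assoc, Nat.reduceAdd] at h1 h2 h3 h4
  simp only [zeroSumCount]
  linarith

lemma six_mul_zeroSumCount (K : ℕ) :
    6 * zeroSumCount (K + 5) =
      (K + 1 : ℤ) ^ 3 + 39 * (K + 1 : ℤ) ^ 2 + 260 * (K + 1 : ℤ) + 402 := by
  induction K using Nat.strong_induction_on with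
  | _ K ih =>
    match K with
    | 0 => decide +kernel
    | 1 => decide +kernel
    | 2 => decide +kernel
    | 3 => decide +kernel
    | K + 4 =>
      have h0 := ih K (by omega)
      have h1 := ih (K + 1) (by omega)
      have h2 := ih (K + 2) (by omega)
      have h3 := ih (K + 3) (by omega)
      have h := zeroSumCount_add_four K
      simp only [Nat.add_assoc, Nat.reduceAdd] at *
      push_cast at *
      rw [h]
      linear_combination 4 * h3 - 6 * h2 + 4 * h1 - h0

lemma card_filter_count_neg_one_eq_zero (K : ℕ) :
    (#{s ∈ signedPowerSums (K + 1) 6 0 | s.count (-1) = 0} : ℤ) = zeroSumCount K := by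
  rw [card_eq_sum_card_fiberwise (f := fun s => s.count 1) (t := range 7)]
  · have h (p : ℕ) (hp : p ∈ range 7) :
        #{s ∈ {s ∈ signedPowerSums (K + 1) 6 0 | s.count (-1) = 0} | s.count 1 = p} =
          if (2 : ℤ) ∣ 0 - p + (0 : ℕ) then
            signedPowerCount K (6 - p - 0) ((0 - p + (0 : ℕ)) / 2) else 0 := by
      rw [mem_range] at hp
      rw [← card_signedPowerSums, ← card_filter_count_signedPowerSums _ _ _ _ _ (by omega),
        filter_filter]
      simp only [and_comm]
    rw [sum_congr rfl h]
    simp [sum_range_succ, zeroSumCount]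
  · intro s hs
    have h1 := (mem_signedPowerSums.1 (mem_filter.1 (mem_coe.1 hs)).1).1
    have h2 := count_one_add_count_neg_one_le s
    simp only [coe_range, Set.mem_Iio]
    omega

/-- The signed power of two `σ(x) * 2 ^ |x|`. -/
def signedPow (x : ℤ) : ℤ := (if 0 ≤ x then 1 else -1) * 2 ^ x.natAbs

lemma signedPow_injective : Function.Injective signedPow := by
  intro x y h
  have hx : (0 : ℤ) < 2 ^ x.natAbs := by positivity
  have hy : (0 : ℤ) < 2 ^ y.natAbs := by positivity
  have key : (2 : ℤ) ^ x.natAbs = 2 ^ y.natAbs → x.natAbs = y.natAbs := fun h =>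
    Nat.pow_right_injective le_rfl (by exact_mod_cast h)
  simp only [signedPow] at h
  split_ifs at h
  · have := key (by linarith)
    omega
  · linarith
  · linarith
  · have := key (by linarith)
    omega

lemma exists_signedPow_eq_iff {K : ℕ} {v : ℤ} :
    (∃ x, (-(K : ℤ) ≤ x ∧ x ≤ K) ∧ signedPow x = v) ↔
      v ∈ signedPowersOfTwo (K + 1) ∧ v ≠ -1 := by
  rw [mem_signedPowersOfTwo]
  constructor
  · rintro ⟨x, hx, rfl⟩
    refine ⟨⟨x.natAbs, by omega, ?_⟩, fun h => ?_⟩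
    · rw [signedPow]
      split_ifs <;> simp
    · have hp : (0 : ℤ) < 2 ^ x.natAbs := by positivity
      rw [signedPow] at h
      split_ifs at h with h0
      · linarith
      · have : (2 : ℤ) ≤ 2 ^ x.natAbs := le_self_pow₀ (by norm_num) (by omega)
        linarith
  · rintro ⟨⟨j, hj, rfl | rfl⟩, hv⟩
    · exact ⟨j, by omega, by simp [signedPow]⟩
    · have : j ≠ 0 := by rintro rfl; simp at hv
      refine ⟨-j, by omega, ?_⟩
      rw [signedPow, if_neg (by omega)]
      simp

lemma Monotone.eq_of_map_univ_eq {k : ℕ} {α : Type*} [PartialOrder α] {x y : Fin k → α}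
    (hx : Monotone x) (hy : Monotone y)
    (h : (univ : Finset (Fin k)).val.map x = univ.val.map y) : x = y := by
  rw [Fin.univ_val_map, Fin.univ_val_map, Multiset.coe_eq_coe] at h
  exact List.ofFn_injective (h.eq_of_sortedLE hx.sortedLE_ofFn hy.sortedLE_ofFn)

lemma Multiset.exists_monotone_map_univ_eq {k : ℕ} {α : Type*} [LinearOrder α] (s : Multiset α)
    (h : s.card = k) :
    ∃ x : Fin k → α, Monotone x ∧ (Finset.univ : Finset (Fin k)).val.map x = s := by
  subst h
  have hl : (s.sort (· ≤ ·)).length = s.card := Multiset.length_sort _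
  refine ⟨fun i => (s.sort (· ≤ ·)).get (i.cast hl.symm), ?_, ?_⟩
  · intro i j hij
    exact (s.pairwise_sort (· ≤ ·)).sortedLE.monotone_get hij
  · rw [Fin.univ_val_map]
    conv_rhs => rw [← Multiset.sort_eq s (· ≤ ·)]
    congr 1
    apply List.ext_get
    · simp
    · simp

lemma ncard_monotone_signedPow_sum_eq_zero (K : ℕ) :
    Set.ncard {x : Fin 6 → ℤ | (∀ i, -(K : ℤ) ≤ x i ∧ x i ≤ K) ∧ Monotone x ∧
        ∑ i, signedPow (x i) = 0} =
      #{s ∈ signedPowerSums (K + 1) 6 0 | s.count (-1) = 0} := by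
  rw [← Set.ncard_coe_finset]
  refine Set.ncard_congr (fun x _ => (univ.val.map x).map signedPow) ?_ ?_ ?_
  · rintro x ⟨h1, -, h3⟩
    have h (i : Fin 6) := exists_signedPow_eq_iff.1 ⟨x i, h1 i, rfl⟩
    simp only [coe_filter, mem_signedPowerSums, Set.mem_ofPred_eq, Multiset.count_eq_zero,
      Multiset.map_map, Multiset.mem_map]
    refine ⟨⟨by simp, ?_, h3⟩, ?_⟩
    · rintro _ ⟨i, -, rfl⟩
      exact (h i).1
    · rintro ⟨i, -, hi⟩
      exact (h i).2 hi
  · rintro x y ⟨-, hx, -⟩ ⟨-, hy, -⟩ h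
    exact hx.eq_of_map_univ_eq hy (Multiset.map_injective signedPow_injective h)
  · intro s hs
    simp only [coe_filter, mem_signedPowerSums, Set.mem_ofPred_eq, Multiset.count_eq_zero] at hs
    obtain ⟨⟨h1, h2, h3⟩, h4⟩ := hs
    have h (v : ℤ) (hv : v ∈ s) := exists_signedPow_eq_iff.2 ⟨h2 v hv, fun e => h4 (e ▸ hv)⟩
    obtain ⟨t, rfl⟩ : ∃ t : Multiset ℤ, t.map signedPow = s :=
      (@Multiset.canLift _ _ signedPow (· ∈ Set.range signedPow) ⟨fun _ hv => hv⟩).prf s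
        fun v hv => (h v hv).imp fun _ hx => hx.2
    obtain ⟨x, hx, rfl⟩ := t.exists_monotone_map_univ_eq (k := 6) (by simpa using h1)
    refine ⟨x, ⟨fun i => ?_, hx, ?_⟩, rfl⟩
    · obtain ⟨y, hy, hxy⟩ := h (signedPow (x i))
        (Multiset.mem_map_of_mem _ (Multiset.mem_map_of_mem _ (mem_univ i)))
      rwa [← signedPow_injective hxy]
    · rwa [Multiset.map_map] at h3

/-- For `n ≥ 1`, `a(n)` is the number of 6-tuples `(x₁,…,x₆)` of integers with
`-(n+4) ≤ x₁ ≤ x₂ ≤ … ≤ x₆ ≤ n+4` and `∑ σ(xᵢ)·2^{|xᵢ|} = 0`, where `σ(x) = 1`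
if `x ≥ 0` and `σ(x) = -1` otherwise (OEIS A187990).  Then
`6·a(n) = n³ + 39n² + 260n + 402`. -/
theorem stmt0 (n : ℕ) (hn : 1 ≤ n) :
    6 * (Set.ncard {x : Fin 6 → ℤ |
        (∀ i : Fin 6, -((n : ℤ) + 4) ≤ x i ∧ x i ≤ (n : ℤ) + 4) ∧
        (∀ i j : Fin 6, i ≤ j → x i ≤ x j) ∧
        (∑ i : Fin 6, (if 0 ≤ x i then (1 : ℤ) else -1) * 2 ^ (x i).natAbs) = 0} : ℤ)
      = (n : ℤ) ^ 3 + 39 * (n : ℤ) ^ 2 + 260 * (n : ℤ) + 402 := by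
  obtain ⟨K, rfl⟩ := Nat.exists_eq_add_of_le' hn
  have h := ncard_monotone_signedPow_sum_eq_zero (K + 1 + 4)
  have h' := six_mul_zeroSumCount K
  rw [← card_filter_count_neg_one_eq_zero, ← h] at h'
  simpa [Monotone, signedPow] using h'
end

section
/- There exist polynomials p0, p1, p2, p3 ∈ ℤ[x], each of degree at most 14 and with p3 ≠ 0, such that p0(n)·a(n) + p1(n)·a(n+1) + p2(n)·a(n+2) + p3(n)·a(n+3) = 0 for all integers n ≥ 1. In particular, the sequence a is D-finite. -/
/-- `a177317 n` is the number of sequences of length `5n` over the alphabet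
`{1,…,5}` (encoded as `Fin 5`) in which each letter occurs exactly `n` times and
any two consecutive entries differ by at most `1` (OEIS A177317). -/
noncomputable def a177317 (n : ℕ) : ℕ :=
  Nat.card {w : Fin (5 * n) → Fin 5 //
    (∀ k : Fin 5, (Finset.filter (fun j => w j = k) Finset.univ).card = n) ∧
    (∀ j : Fin (5 * n), ∀ h : (j : ℕ) + 1 < 5 * n,
      |((w j : ℕ) : ℤ) - ((w ⟨(j : ℕ) + 1, h⟩ : ℕ) : ℤ)| ≤ 1)}

theorem cast_choose_mul_succ (n k : ℕ) :
    (n.choose k : ℚ) * (n + 1) = (n + 1).choose k * (n + 1 - k) := by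
  rcases le_or_gt k (n + 1) with h | h
  · have := Nat.choose_mul_succ_eq n k
    have h2 : ((n + 1 - k : ℕ) : ℚ) = n + 1 - k := by push_cast [Nat.cast_sub h]; ring
    rw [← h2]; exact_mod_cast this
  · rw [Nat.choose_eq_zero_of_lt h, Nat.choose_eq_zero_of_lt (by omega)]; simp

theorem cast_choose_succ_right (n k : ℕ) :
    (n.choose (k + 1) : ℚ) * (k + 1) = n.choose k * (n - k) := by
  rcases le_or_gt k n with h | h
  · have := Nat.choose_succ_right_eq n k
    rw [← Nat.cast_sub h]; exact_mod_cast this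
  · rw [Nat.choose_eq_zero_of_lt h, Nat.choose_eq_zero_of_lt (by omega)]; simp

theorem cast_choose_succ_succ (n k : ℕ) :
    ((n + 1).choose (k + 1) : ℚ) * (k + 1) = (n + 1) * n.choose k := by
  exact_mod_cast (Nat.add_one_mul_choose_eq n k).symm

/-- The common hypergeometric factor of the inner sums. -/
def innerTerm (n m l : ℕ) : ℚ := m.choose l * n.choose l * (2 * n - l).choose n

theorem innerTerm_of_lt {n m l : ℕ} (h : n < l) : innerTerm n m l = 0 := by
  simp [innerTerm, Nat.choose_eq_zero_of_lt h]

theorem innerTerm_succ {n l : ℕ} (m : ℕ) (hn : 0 < n) (h : l ≤ n) :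
    innerTerm n m (l + 1) =
      innerTerm n m l * ((m - l) * (n - l) ^ 2 / ((l + 1) ^ 2 * (2 * n - l))) := by
  obtain ⟨j, rfl⟩ := Nat.exists_eq_add_of_le h
  have e : 2 * (l + j) - l = (2 * (l + j) - (l + 1)) + 1 := by omega
  have h1 := cast_choose_succ_right m l
  have h2 := cast_choose_succ_right (l + j) l
  have h3 := cast_choose_mul_succ (2 * (l + j) - (l + 1)) (l + j)
  rw [← e] at h3
  have e' : ((2 * (l + j) - (l + 1) : ℕ) : ℚ) = l + 2 * j - 1 := by
    rw [Nat.cast_sub (by omega)]; push_cast; ring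
  rw [e'] at h3
  have p1 : (l + 1 : ℚ) ≠ 0 := by positivity
  have p2 : (2 * ((l : ℚ) + j) - l) ≠ 0 := by
    have : (0 : ℚ) < l + j := by exact_mod_cast hn
    have : (0 : ℚ) ≤ j := by positivity
    linarith
  have p3 : (l + 2 * j : ℚ) ≠ 0 := by convert p2 using 1; ring
  push_cast at h2 h3 ⊢
  unfold innerTerm
  rw [mul_div_assoc', eq_div_iff (by positivity)]
  have h3' : ((2 * (l + j) - (l + 1)).choose (l + j) : ℚ) * (l + 2 * j) =
    (2 * (l + j) - l).choose (l + j) * j := by linear_combination h3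
  linear_combination
    ((l + j).choose (l + 1) : ℚ) * (l + 1) * ((2 * (l + j) - (l + 1)).choose (l + j) : ℚ) *
        (l + 2 * j) * h1 +
      (m.choose l : ℚ) * (m - l) * ((2 * (l + j) - (l + 1)).choose (l + j) : ℚ) *
        (l + 2 * j) * h2 +
      (m.choose l : ℚ) * (m - l) * ((l + j).choose l : ℚ) * j * h3'

theorem innerTerm_succ_middle (n m l : ℕ) :
    innerTerm n m l = innerTerm n (m + 1) l * ((m + 1 - l) / (m + 1)) := by
  have h := cast_choose_mul_succ m l
  unfold innerTerm
  rw [mul_div_assoc', eq_div_iff (by positivity)]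
  linear_combination (n.choose l : ℚ) * (2 * n - l).choose n * h

theorem innerTerm_succ_left {n l : ℕ} (m : ℕ) (h : l ≤ n) :
    innerTerm (n + 1) m l =
      innerTerm n m l * ((2 * n + 2 - l) * (2 * n + 1 - l) / (n + 1 - l) ^ 2) := by
  obtain ⟨j, rfl⟩ := Nat.exists_eq_add_of_le h
  have h1 := cast_choose_mul_succ (l + j) l
  have e1 : 2 * (l + j + 1) - l = l + 2 * j + 1 + 1 := by omega
  have e2 : 2 * (l + j) - l = l + 2 * j := by omega
  have h2 := cast_choose_mul_succ (l + 2 * j) (l + j)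
  have h3 := cast_choose_succ_succ (l + 2 * j + 1) (l + j)
  unfold innerTerm
  rw [e1, e2]
  push_cast at *
  have p1 : ((l : ℚ) + j + 1 - l) ≠ 0 := by
    have : (0 : ℚ) < j + 1 := by positivity
    linarith
  rw [mul_div_assoc', eq_div_iff (by positivity)]
  have p2 : ((l : ℚ) + j + 1) ≠ 0 := by positivity
  apply mul_right_cancel₀ p2
  have hsucc : ((l + 2 * j).choose (l + j) : ℚ) * (l + 2 * j + 1) =
    (l + 2 * j + 1).choose (l + j) * (j + 1) := by linear_combination h2
  linear_combination
    (-(m.choose l : ℚ) * (j + 1) * ((l + 2 * j + 1 + 1).choose (l + j + 1) : ℚ) * (l + j + 1)) * h1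
    + (m.choose l : ℚ) * ((l + j).choose l : ℚ) * (j + 1) * (l + j + 1) * h3
    - (m.choose l : ℚ) * ((l + j).choose l : ℚ) * (l + j + 1) * (l + 2 * j + 2) * hsucc

/-- `∑ₗ C(m,l) C(2n-l-1,n) C(n-1,l-1)`. -/
def innerB (n m : ℕ) : ℚ :=
  ∑ l ∈ Finset.range (n + 1), innerTerm n m l * (l * (n - l) / (n * (2 * n - l)))

/-- `∑ₗ C(m,l) C(2n-l-1,n) C(n-1,l)`. -/
def innerC (n m : ℕ) : ℚ :=
  ∑ l ∈ Finset.range (n + 1), innerTerm n m l * ((n - l) ^ 2 / (n * (2 * n - l)))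

/-- `∑ₗ C(m,l) C(2n-l-1,n) C(n+1,l+1)`. -/
def innerA (n m : ℕ) : ℚ :=
  ∑ l ∈ Finset.range (n + 1),
    innerTerm n m l * ((n + 1) * (n - l) / ((l + 1) * (2 * n - l)))

theorem sum_range_eq_zero_of_telescoping {N : ℕ} {F G : ℕ → ℚ} (h0 : G 0 = 0) (hN : G N = 0)
    (h : ∀ l < N, F l = G (l + 1) - G l) : ∑ l ∈ Finset.range N, F l = 0 := by
  rw [Finset.sum_congr rfl fun l hl => h l (Finset.mem_range.mp hl), Finset.sum_range_sub, h0, hN,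
    sub_zero]

theorem denominators_ne_zero {n l : ℕ} (hn : 0 < n) (h : l < n + 1) :
    (n : ℚ) ≠ 0 ∧ (n * 2 - l : ℚ) ≠ 0 ∧ (n + 1 - l : ℚ) ≠ 0 ∧ ((n + 1) * 2 - l : ℚ) ≠ 0 := by
  have h1 : (0 : ℚ) < n := by exact_mod_cast hn
  have h2 : (l : ℚ) ≤ n := by exact_mod_cast Nat.lt_succ_iff.mp h
  refine ⟨?_, ?_, ?_, ?_⟩ <;> apply ne_of_gt <;> linarith

theorem innerA_eq {n : ℕ} (hn : 0 < n) (m : ℕ) :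
    (m + 1) * innerA n m = (1 + m + n) * innerB n m + (1 + 2 * m + n) * innerC n m := by
  rw [← sub_eq_zero]
  unfold innerA innerB innerC
  simp only [Finset.mul_sum, ← Finset.sum_add_distrib, ← Finset.sum_sub_distrib]
  apply sum_range_eq_zero_of_telescoping
    (G := fun l => innerTerm n m l * (l * (n - l) / n))
  · simp
  · simp [innerTerm_of_lt (Nat.lt_succ_self n)]
  · intro l hl
    obtain ⟨p1, p2, -⟩ := denominators_ne_zero hn hl
    simp only [innerTerm_succ m hn (Nat.lt_succ_iff.mp hl)]
    push_cast
    field_simp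
    ring

theorem innerB_succ_right {n : ℕ} (hn : 0 < n) (m : ℕ) :
    (m + 1 - 2 * n) * innerB n (m + 1) = (m + 1 - n) * innerB n m + (1 - n) * innerC n m := by
  rw [← sub_eq_zero]
  unfold innerB innerC
  simp only [Finset.mul_sum, ← Finset.sum_add_distrib, ← Finset.sum_sub_distrib]
  apply sum_range_eq_zero_of_telescoping
    (G := fun l => innerTerm n (m + 1) l * (l ^ 2 * (n - l) / (n * (m + 1))))
  · simp
  · simp [innerTerm_of_lt (Nat.lt_succ_self n)]
  · intro l hl
    obtain ⟨p1, p2, -⟩ := denominators_ne_zero hn hl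
    have p2' : (2 * n - l : ℚ) ≠ 0 := by rwa [mul_comm] at p2
    simp only [innerTerm_succ_middle n m]
    simp only [innerTerm_succ (m + 1) hn (Nat.lt_succ_iff.mp hl)]
    push_cast
    field_simp
    ring

theorem innerC_succ_right {n : ℕ} (hn : 0 < n) (m : ℕ) :
    (m + 1) * (m + 1 - 2 * n) * innerC n (m + 1) =
      -n ^ 2 * innerB n m + (m + m ^ 2 - n * m - n ^ 2) * innerC n m := by
  rw [← sub_eq_zero]
  unfold innerB innerC
  simp only [Finset.mul_sum, ← Finset.sum_add_distrib, ← Finset.sum_sub_distrib]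
  apply sum_range_eq_zero_of_telescoping
    (G := fun l => innerTerm n (m + 1) l * ((n - 1 - m) * l ^ 2 * (n - l) / (n * (m + 1))))
  · simp
  · simp [innerTerm_of_lt (Nat.lt_succ_self n)]
  · intro l hl
    obtain ⟨p1, p2, -⟩ := denominators_ne_zero hn hl
    have p2' : (2 * n - l : ℚ) ≠ 0 := by rwa [mul_comm] at p2
    simp only [innerTerm_succ_middle n m]
    simp only [innerTerm_succ (m + 1) hn (Nat.lt_succ_iff.mp hl)]
    push_cast
    field_simp
    ring

theorem innerB_succ_left {n : ℕ} (hn : 0 < n) (m : ℕ) :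
    (n + 1) ^ 2 * innerB (n + 1) m =
      n * (1 + m + n) * innerB n m + (m + 3 * n * m) * innerC n m := by
  rw [← sub_eq_zero]
  unfold innerB innerC
  rw [Finset.sum_range_succ _ (n + 1)]
  simp only [Nat.cast_add, Nat.cast_one, sub_self, mul_zero, zero_div, add_zero]
  simp only [Finset.mul_sum, ← Finset.sum_add_distrib, ← Finset.sum_sub_distrib]
  apply sum_range_eq_zero_of_telescoping
    (G := fun l => -(innerTerm n m l *
      ((3 * n ^ 2 + 3 * n + 1 - (2 * n + 1) * l) * l ^ 2 / (n * (n + 1 - l)))))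
  · simp
  · simp [innerTerm_of_lt (Nat.lt_succ_self n)]
  · intro l hl
    obtain ⟨p1, p2, p3, p4⟩ := denominators_ne_zero hn hl
    rcases (Nat.lt_succ_iff.mp hl).lt_or_eq with hl' | rfl
    · have p6 : (n - l : ℚ) ≠ 0 := sub_ne_zero.mpr (by exact_mod_cast hl'.ne')
      simp only [innerTerm_succ m hn hl'.le, innerTerm_succ_left m hl'.le]
      push_cast
      rw [show (n + 1 - (l + 1) : ℚ) = n - l by ring]
      field_simp
      ring
    · simp only [innerTerm_of_lt (Nat.lt_succ_self l), innerTerm_succ_left m le_rfl]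
      field_simp
      ring

theorem innerC_succ_left {n : ℕ} (hn : 0 < n) (m : ℕ) :
    n * (n + 1) * innerC (n + 1) m =
      (2 * n + 3 * n ^ 2) * innerB n m + (m + 2 * n + n * m + 4 * n ^ 2) * innerC n m := by
  rw [← sub_eq_zero]
  unfold innerB innerC
  rw [Finset.sum_range_succ _ (n + 1)]
  simp only [Nat.cast_add, Nat.cast_one, sub_self, mul_zero, zero_div, add_zero,
    zero_pow two_ne_zero]
  simp only [Finset.mul_sum, ← Finset.sum_add_distrib, ← Finset.sum_sub_distrib]
  apply sum_range_eq_zero_of_telescoping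
    (G := fun l => -(innerTerm n m l * ((n + 1) * l ^ 2 / n)))
  · simp
  · simp [innerTerm_of_lt (Nat.lt_succ_self n)]
  · intro l hl
    obtain ⟨p1, p2, p3, p4⟩ := denominators_ne_zero hn hl
    simp only [innerTerm_succ m hn (Nat.lt_succ_iff.mp hl),
      innerTerm_succ_left m (Nat.lt_succ_iff.mp hl)]
    push_cast
    field_simp
    ring

/-- The coefficient of `a(n)` in the recurrence. -/
def recurrenceCoeff0 {R : Type*} [CommRing R] (x : R) : R :=
  -354051 * x ^ 14 - 6438906 * x ^ 13 - 52292709 * x ^ 12 - 249887460 * x ^ 11 -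
  778997331 * x ^ 10 - 1658947494 * x ^ 9 - 2454191463 * x ^ 8 - 2510703840 * x ^ 7 -
  1730154198 * x ^ 6 - 758552940 * x ^ 5 - 188227848 * x ^ 4 - 19686960 * x ^ 3

/-- The coefficient of `a(n + 1)` in the recurrence. -/
def recurrenceCoeff1 {R : Type*} [CommRing R] (x : R) : R :=
  878571 * x ^ 14 + 17735168 * x ^ 13 + 162486998 * x ^ 12 + 894166454 * x ^ 11 +
  3296854502 * x ^ 10 + 8603403878 * x ^ 9 + 16367262056 * x ^ 8 + 23042149818 * x ^ 7 +
  24121240143 * x ^ 6 + 18703485978 * x ^ 5 + 10599568314 * x ^ 4 + 4273805232 * x ^ 3 +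
  1164684456 * x ^ 2 + 192951072 * x + 14722560

/-- The coefficient of `a(n + 2)` in the recurrence. -/
def recurrenceCoeff2 {R : Type*} [CommRing R] (x : R) : R :=
  -1337526 * x ^ 14 - 29674860 * x ^ 13 - 300828222 * x ^ 12 - 1845307904 * x ^ 11 -
  7645330392 * x ^ 10 - 22614694716 * x ^ 9 - 49220175942 * x ^ 8 - 80041784964 * x ^ 7 -
  97720981818 * x ^ 6 - 89160426748 * x ^ 5 - 59886565092 * x ^ 4 - 28739078808 * x ^ 3 -
  9319592688 * x ^ 2 - 1826749152 * x - 162960768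

/-- The coefficient of `a(n + 3)` in the recurrence. -/
def recurrenceCoeff3 {R : Type*} [CommRing R] (x : R) : R :=
  13113 * x ^ 14 + 317156 * x ^ 13 + 3485182 * x ^ 12 + 23044934 * x ^ 11 + 102362074 * x ^ 10 +
  322910078 * x ^ 9 + 745726744 * x ^ 8 + 1280524302 * x ^ 7 + 1643152101 * x ^ 6 +
  1568813838 * x ^ 5 + 1098140922 * x ^ 4 + 547158348 * x ^ 3 + 183611448 * x ^ 2 +
  37126512 * x + 3405888

/-- Numerator of the `innerB` part of the telescoping certificate. -/
def certificateB (x y : ℚ) : ℚ :=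
    (-31602330 * x ^ 14 - 638198900 * x ^ 13 - 5863844292 * x ^ 12 - 32472383756 * x ^ 11 -
      121039707062 * x ^ 10 - 321227134876 * x ^ 9 - 626062216524 * x ^ 8 -
      910716906172 * x ^ 7 - 994270801108 * x ^ 6 - 811246009416 * x ^ 5 -
      487161639372 * x ^ 4 - 208769228736 * x ^ 3 - 60308887296 * x ^ 2 - 10498581792 * x -
      829709568) *
      (x + 1) ^ 2 * (x + 2) ^ 2 * (x + 3) +
    (-16902657 * x ^ 16 - 518622346 * x ^ 15 - 7011074467 * x ^ 14 - 56150076435 * x ^ 13 -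
      300314219095 * x ^ 12 - 1142190771081 * x ^ 11 - 3203871779265 * x ^ 10 -
      6772896811461 * x ^ 9 - 10919684454496 * x ^ 8 - 13488917806949 * x ^ 7 -
      12742437619296 * x ^ 6 - 9124142181852 * x ^ 5 - 4864146702492 * x ^ 4 -
      1869758965044 * x ^ 3 - 489305622792 * x ^ 2 - 77891398272 * x - 5676324480) *
      (x + 1) * (x + 2) * y +
    (68620329 * x ^ 17 + 1756897130 * x ^ 16 + 20753053413 * x ^ 15 + 150052114388 * x ^ 14 +
      742940684450 * x ^ 13 + 2669967568518 * x ^ 12 + 7202938566720 * x ^ 11 +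
      14880883226064 * x ^ 10 + 23806041721289 * x ^ 9 + 29627020983012 * x ^ 8 +
      28659594882939 * x ^ 7 + 21418673654672 * x ^ 6 + 12219619094504 * x ^ 5 +
      5218047903504 * x ^ 4 + 1615783640964 * x ^ 3 + 343774364520 * x ^ 2 + 45234833184 * x +
      2799239040) *
      y ^ 2 +
    (-25426107 * x ^ 16 - 522938450 * x ^ 15 - 4781567546 * x ^ 14 - 25261457915 * x ^ 13 -
      82599443974 * x ^ 12 - 156698625221 * x ^ 11 - 77774319028 * x ^ 10 +
      483007739939 * x ^ 9 + 1687536940369 * x ^ 8 + 3083647332743 * x ^ 7 +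
      3763648307526 * x ^ 6 + 3243377015156 * x ^ 5 + 1986895627536 * x ^ 4 +
      847022228724 * x ^ 3 + 238428145032 * x ^ 2 + 39710176416 * x + 2952581760) *
      y ^ 3 +
    (-7697331 * x ^ 15 - 197028136 * x ^ 14 - 2282187770 * x ^ 13 - 15888552566 * x ^ 12 -
      74421312042 * x ^ 11 - 248594009468 * x ^ 10 - 612100977062 * x ^ 9 -
      1131717877726 * x ^ 8 - 1584473166243 * x ^ 7 - 1679641414488 * x ^ 6 -
      1336359017756 * x ^ 5 - 782741441736 * x ^ 4 - 326120003172 * x ^ 3 -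
      91032957480 * x ^ 2 - 15189046560 * x - 1140234624) *
      y ^ 4 +
    (3671640 * x ^ 14 + 74051555 * x ^ 13 + 679902394 * x ^ 12 + 3767319705 * x ^ 11 +
      14081351082 * x ^ 10 + 37588757041 * x ^ 9 + 73965475146 * x ^ 8 + 109062791591 * x ^ 7 +
      121081537982 * x ^ 6 + 100591286944 * x ^ 5 + 61391748468 * x ^ 4 + 26587777356 * x ^ 3 +
      7691680584 * x ^ 2 + 1325830752 * x + 102556800) *
      y ^ 5

/-- Numerator of the `innerC` part of the telescoping certificate. -/
def certificateC (x y : ℚ) : ℚ :=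
    (-34801902 * x ^ 14 - 700557466 * x ^ 13 - 6415711114 * x ^ 12 - 35409234770 * x ^ 11 -
      131529370154 * x ^ 10 - 347797470994 * x ^ 9 - 675198819510 * x ^ 8 -
      977918290910 * x ^ 7 - 1062234320664 * x ^ 6 - 861393329508 * x ^ 5 -
      513339520368 * x ^ 4 - 217889640000 * x ^ 3 - 62200089120 * x ^ 2 - 10673770752 * x -
      829709568) *
      x * (x + 1) ^ 2 * (x + 2) ^ 2 * (x + 3) +
    (-36336123 * x ^ 17 - 1030281313 * x ^ 16 - 13211384460 * x ^ 15 - 102073721230 * x ^ 14 -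
      533154819404 * x ^ 13 - 1999939534486 * x ^ 12 - 5582280418826 * x ^ 11 -
      11847505954588 * x ^ 10 - 19364844266881 * x ^ 9 - 24532807790969 * x ^ 8 -
      24114695019946 * x ^ 7 - 18313068652542 * x ^ 6 - 10630292959896 * x ^ 5 -
      4624629194184 * x ^ 4 - 1457595305952 * x ^ 3 - 313778778336 * x ^ 2 - 41209905600 * x -
      2489128704) *
      (x + 1) * (x + 2) * y +
    (63847197 * x ^ 18 + 1547786187 * x ^ 17 + 17105385326 * x ^ 16 + 113771296780 * x ^ 15 +
      505372871556 * x ^ 14 + 1566324035018 * x ^ 13 + 3402300761844 * x ^ 12 +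
      4911475688100 * x ^ 11 + 3548348832809 * x ^ 10 - 2572749307885 * x ^ 9 -
      11548095128822 * x ^ 8 - 18002060877680 * x ^ 7 - 17962713045554 * x ^ 6 -
      12627889270128 * x ^ 5 - 6378058638516 * x ^ 4 - 2283538944792 * x ^ 3 -
      554009973456 * x ^ 2 - 82240111584 * x - 5676324480) *
      y ^ 2 +
    (21741354 * x ^ 17 + 705623878 * x ^ 16 + 9961028825 * x ^ 15 + 82886862564 * x ^ 14 +
      460034295172 * x ^ 13 + 1817299050804 * x ^ 12 + 5306762450156 * x ^ 11 +
      11716960613994 * x ^ 10 + 19809969741658 * x ^ 9 + 25781666140822 * x ^ 8 +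
      25797488884571 * x ^ 7 + 19694205352006 * x ^ 6 + 11295926760412 * x ^ 5 +
      4744157964588 * x ^ 4 + 1399525500876 * x ^ 3 + 270467751408 * x ^ 2 + 30057324912 * x +
      1399619520) *
      y ^ 3 +
    (-37398276 * x ^ 16 - 863301640 * x ^ 15 - 9110041343 * x ^ 14 - 58180847185 * x ^ 13 -
      250910802515 * x ^ 12 - 771809034741 * x ^ 11 - 1742697854149 * x ^ 10 -
      2924583841651 * x ^ 9 - 3643249799693 * x ^ 8 - 3308871810463 * x ^ 7 -
      2086026274196 * x ^ 6 - 790135758332 * x ^ 5 - 60916632612 * x ^ 4 +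
      110640862380 * x ^ 3 + 62888797632 * x ^ 2 + 15219800784 * x + 1476290880) *
      y ^ 4 +
    (7041681 * x ^ 15 + 130763964 * x ^ 14 + 1066306492 * x ^ 13 + 4938032028 * x ^ 12 +
      13714232832 * x ^ 11 + 20005984626 * x ^ 10 - 3648797944 * x ^ 9 - 89560263684 * x ^ 8 -
      225465109529 * x ^ 7 - 332717949738 * x ^ 6 - 332417258992 * x ^ 5 -
      231906603468 * x ^ 4 - 111742931868 * x ^ 3 - 35510247888 * x ^ 2 - 6703665840 * x -
      570117312) *
      y ^ 5 +
    (799893 * x ^ 12 + 14547158 * x ^ 11 + 118883131 * x ^ 10 + 577015436 * x ^ 9 +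
      1851756259 * x ^ 8 + 4137164914 * x ^ 7 + 6591880333 * x ^ 6 + 7533969328 * x ^ 5 +
      6113319276 * x ^ 4 + 3422657028 * x ^ 3 + 1251266580 * x ^ 2 + 268255224 * x + 25639200) *
      (x + 1) * (x + 2) * y ^ 6

/-- The ratio of the outer summand to its hypergeometric factor. -/
def outerRatio (x y b c : ℚ) : ℚ :=
  (x - y) / (x ^ 2 * (y + 1) ^ 2) *
    (x * (x ^ 2 - x * y + y ^ 2 + 2 * y + 1) * b + (x - y) * (x ^ 2 + x * y + y + 1) * c)

/-- The ratio of the telescoping certificate to the hypergeometric factor. -/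
def certificateRatio (x y b c : ℚ) : ℚ :=
  (x + 3 - y) * y ^ 2 * (x * certificateB x y * b + certificateC x y * c) /
    (x * (x + 1) ^ 3 * (x + 2) ^ 3 * (x + 3) ^ 2)

set_option maxHeartbeats 4000000 in
theorem certificate_identity {x y b c b₁ c₁ b₂ c₂ b₃ c₃ b' c' : ℚ} (h0 : x ≠ 0) (h1 : x + 1 ≠ 0)
    (h2 : x + 2 ≠ 0) (h3 : x + 3 ≠ 0) (hy : y + 1 ≠ 0) (hxy : y + 1 - 2 * x ≠ 0)
    (hb₁ : (x + 1) ^ 2 * b₁ = x * (1 + y + x) * b + (y + 3 * x * y) * c)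
    (hc₁ : x * (x + 1) * c₁ = (2 * x + 3 * x ^ 2) * b + (y + 2 * x + x * y + 4 * x ^ 2) * c)
    (hb₂ : (x + 2) ^ 2 * b₂ = (x + 1) * (2 + y + x) * b₁ + (4 * y + 3 * x * y) * c₁)
    (hc₂ : (x + 1) * (x + 2) * c₂ = (2 * (x + 1) + 3 * (x + 1) ^ 2) * b₁ +
      (y + 2 * (x + 1) + (x + 1) * y + 4 * (x + 1) ^ 2) * c₁)
    (hb₃ : (x + 3) ^ 2 * b₃ = (x + 2) * (3 + y + x) * b₂ + (7 * y + 3 * x * y) * c₂)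
    (hc₃ : (x + 2) * (x + 3) * c₃ = (2 * (x + 2) + 3 * (x + 2) ^ 2) * b₂ +
      (y + 2 * (x + 2) + (x + 2) * y + 4 * (x + 2) ^ 2) * c₂)
    (hb' : (y + 1 - 2 * x) * b' = (y + 1 - x) * b + (1 - x) * c)
    (hc' : (y + 1) * (y + 1 - 2 * x) * c' = -x ^ 2 * b + (y + y ^ 2 - x * y - x ^ 2) * c) :
    recurrenceCoeff0 x *
        (((x + 1 - y) * (x + 2 - y) * (x + 3 - y)) ^ 2 / ((x + 1) * (x + 2) * (x + 3)) ^ 2) *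
        outerRatio x y b c +
      recurrenceCoeff1 x *
        (((x + 2 - y) * (x + 3 - y)) ^ 2 * (x + 1 + y) / (((x + 2) * (x + 3)) ^ 2 * (x + 1))) *
        outerRatio (x + 1) y b₁ c₁ +
      recurrenceCoeff2 x *
        ((x + 3 - y) ^ 2 * ((x + 1 + y) * (x + 2 + y)) / ((x + 3) ^ 2 * ((x + 1) * (x + 2)))) *
        outerRatio (x + 2) y b₂ c₂ +
      recurrenceCoeff3 x *
        ((x + 1 + y) * (x + 2 + y) * (x + 3 + y) / ((x + 1) * (x + 2) * (x + 3))) *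
        outerRatio (x + 3) y b₃ c₃ =
      (x + 3 - y) ^ 2 * (x + 1 + y) / (y + 1) ^ 3 * certificateRatio x (y + 1) b' c' -
        certificateRatio x y b c := by
  have e₁ : b₁ = (x * (1 + y + x) * b + (y + 3 * x * y) * c) / (x + 1) ^ 2 := by
    rw [eq_div_iff (by positivity), ← hb₁]; ring
  have f₁ : c₁ = ((2 * x + 3 * x ^ 2) * b + (y + 2 * x + x * y + 4 * x ^ 2) * c) /
      (x * (x + 1)) := by
    rw [eq_div_iff (by positivity), ← hc₁]; ring
  have e₂ : b₂ = ((x + 1) * (2 + y + x) * b₁ + (4 * y + 3 * x * y) * c₁) / (x + 2) ^ 2 := by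
    rw [eq_div_iff (by positivity), ← hb₂]; ring
  have f₂ : c₂ = ((2 * (x + 1) + 3 * (x + 1) ^ 2) * b₁ +
      (y + 2 * (x + 1) + (x + 1) * y + 4 * (x + 1) ^ 2) * c₁) / ((x + 1) * (x + 2)) := by
    rw [eq_div_iff (by positivity), ← hc₂]; ring
  have e₃ : b₃ = ((x + 2) * (3 + y + x) * b₂ + (7 * y + 3 * x * y) * c₂) / (x + 3) ^ 2 := by
    rw [eq_div_iff (by positivity), ← hb₃]; ring
  have f₃ : c₃ = ((2 * (x + 2) + 3 * (x + 2) ^ 2) * b₂ +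
      (y + 2 * (x + 2) + (x + 2) * y + 4 * (x + 2) ^ 2) * c₂) / ((x + 2) * (x + 3)) := by
    rw [eq_div_iff (by positivity), ← hc₃]; ring
  have e' : b' = ((y + 1 - x) * b + (1 - x) * c) / (y + 1 - 2 * x) := by
    rw [eq_div_iff hxy, ← hb']; ring
  have f' : c' = (-x ^ 2 * b + (y + y ^ 2 - x * y - x ^ 2) * c) /
      ((y + 1) * (y + 1 - 2 * x)) := by
    rw [eq_div_iff (by positivity), ← hc']; ring
  unfold outerRatio certificateRatio
  rw [e₃, f₃, e₂, f₂, e₁, f₁, e', f']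
  generalize hp0 : recurrenceCoeff0 x = p0
  generalize hp1 : recurrenceCoeff1 x = p1
  generalize hp2 : recurrenceCoeff2 x = p2
  generalize hp3 : recurrenceCoeff3 x = p3
  generalize hp4 : certificateB x y = p4
  generalize hp5 : certificateC x y = p5
  generalize hp6 : certificateB x (y + 1) = p6
  generalize hp7 : certificateC x (y + 1) = p7
  have hxy' : y + 1 - x * 2 ≠ 0 := by rwa [mul_comm x]
  field_simp
  subst hp0 hp1 hp2 hp3 hp4 hp5 hp6 hp7
  unfold recurrenceCoeff0 recurrenceCoeff1 recurrenceCoeff2 recurrenceCoeff3 certificateB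
    certificateC
  ring

/-- The summand of the outer sum. -/
def outerTerm (n m : ℕ) : ℚ :=
  (n.choose m) ^ 2 * (n + m).choose n * outerRatio n m (innerB n m) (innerC n m)

/-- The outer sum, equal to `a177317 n` for `1 ≤ n`. -/
def outerSum (n : ℕ) : ℚ := ∑ m ∈ Finset.range (n + 1), outerTerm n m

theorem outerSum_eq {n K : ℕ} (h : n + 1 ≤ K) :
    outerSum n = ∑ m ∈ Finset.range K, outerTerm n m := by
  apply Finset.sum_subset (Finset.range_subset_range.mpr h)
  intro m _ hm
  rw [Finset.mem_range, not_lt] at hm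
  simp [outerTerm, Nat.choose_eq_zero_of_lt hm]

theorem cast_choose_eq_succ (n m : ℕ) :
    (n.choose m : ℚ) = (n + 1).choose m * ((n + 1 - m) / (n + 1)) := by
  rw [mul_div_assoc', eq_div_iff (by positivity)]
  exact cast_choose_mul_succ n m

theorem cast_choose_add_succ (n m : ℕ) :
    ((n + 1 + m).choose (n + 1) : ℚ) = (n + m).choose n * ((n + 1 + m) / (n + 1)) := by
  have h := cast_choose_succ_succ (n + m) n
  rw [mul_div_assoc', eq_div_iff (by positivity), show n + 1 + m = n + m + 1 by ring, h]
  push_cast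
  ring

/-- The common hypergeometric factor of four consecutive outer summands. -/
def outerFactor (n m : ℕ) : ℚ := ((n + 3).choose m) ^ 2 * (n + m).choose n

theorem outerTerm_eq (n m : ℕ) : outerTerm n m = outerFactor n m *
    (((n + 1 - m) * (n + 2 - m) * (n + 3 - m)) ^ 2 / ((n + 1) * (n + 2) * (n + 3)) ^ 2) *
      outerRatio n m (innerB n m) (innerC n m) := by
  rw [outerTerm, outerFactor, cast_choose_eq_succ n m, cast_choose_eq_succ (n + 1) m,
    cast_choose_eq_succ (n + 2) m]
  push_cast
  field_simp
  ring

theorem outerTerm_add_one_eq (n m : ℕ) : outerTerm (n + 1) m = outerFactor n m *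
    (((n + 2 - m) * (n + 3 - m)) ^ 2 * (n + 1 + m) / (((n + 2) * (n + 3)) ^ 2 * (n + 1))) *
      outerRatio (n + 1) m (innerB (n + 1) m) (innerC (n + 1) m) := by
  rw [outerTerm, outerFactor, cast_choose_eq_succ (n + 1) m, cast_choose_eq_succ (n + 2) m,
    cast_choose_add_succ]
  push_cast
  field_simp
  ring

theorem outerTerm_add_two_eq (n m : ℕ) : outerTerm (n + 2) m = outerFactor n m *
    ((n + 3 - m) ^ 2 * ((n + 1 + m) * (n + 2 + m)) / ((n + 3) ^ 2 * ((n + 1) * (n + 2)))) *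
      outerRatio (n + 2) m (innerB (n + 2) m) (innerC (n + 2) m) := by
  rw [outerTerm, outerFactor, cast_choose_eq_succ (n + 2) m, cast_choose_add_succ (n + 1),
    cast_choose_add_succ]
  push_cast
  field_simp
  ring

theorem outerTerm_add_three_eq (n m : ℕ) : outerTerm (n + 3) m = outerFactor n m *
    ((n + 1 + m) * (n + 2 + m) * (n + 3 + m) / ((n + 1) * (n + 2) * (n + 3))) *
      outerRatio (n + 3) m (innerB (n + 3) m) (innerC (n + 3) m) := by
  rw [outerTerm, outerFactor, cast_choose_add_succ (n + 2), cast_choose_add_succ (n + 1),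
    cast_choose_add_succ]
  push_cast
  field_simp
  ring

theorem outerFactor_succ (n m : ℕ) : outerFactor n (m + 1) =
    outerFactor n m * ((n + 3 - m) ^ 2 * (n + 1 + m) / (m + 1) ^ 3) := by
  have h := cast_choose_succ_right (n + 3) m
  have h' := cast_choose_mul_succ (n + m) n
  unfold outerFactor
  rw [mul_div_assoc', eq_div_iff (by positivity), ← add_assoc n m 1]
  push_cast at h h'
  have h'' : ((n + m).choose n : ℚ) * (n + m + 1) = (n + m + 1).choose n * (m + 1) := by
    linear_combination h'
  linear_combination ((n + m + 1).choose n : ℚ) * (m + 1) *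
    (((n + 3).choose (m + 1) : ℚ) * (m + 1) + (n + 3).choose m * (n + 3 - m)) * h -
    ((n + 3).choose m : ℚ) ^ 2 * (n + 3 - m) ^ 2 * h''

theorem outerSum_recurrence {n : ℕ} (hn : 5 ≤ n) :
    recurrenceCoeff0 (n : ℚ) * outerSum n + recurrenceCoeff1 (n : ℚ) * outerSum (n + 1) +
      recurrenceCoeff2 (n : ℚ) * outerSum (n + 2) +
      recurrenceCoeff3 (n : ℚ) * outerSum (n + 3) = 0 := by
  rw [outerSum_eq (show n + 1 ≤ n + 4 by omega), outerSum_eq (show n + 1 + 1 ≤ n + 4 by omega),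
    outerSum_eq (show n + 2 + 1 ≤ n + 4 by omega), outerSum_eq (show n + 3 + 1 ≤ n + 4 by omega)]
  simp only [Finset.mul_sum, ← Finset.sum_add_distrib]
  apply sum_range_eq_zero_of_telescoping
    (G := fun m => outerFactor n m * certificateRatio n m (innerB n m) (innerC n m))
  · simp [certificateRatio]
  · simp [outerFactor]
  · intro m hm
    have hn0 : 0 < n := by omega
    have p0 : (n : ℚ) ≠ 0 := by positivity
    have p1 : (n + 1 : ℚ) ≠ 0 := by positivity
    have p2 : (n + 2 : ℚ) ≠ 0 := by positivity
    have p3 : (n + 3 : ℚ) ≠ 0 := by positivity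
    have p4 : (m + 1 : ℚ) ≠ 0 := by positivity
    have p5 : (m + 1 - 2 * n : ℚ) ≠ 0 := by
      have : (m + 1 : ℚ) < 2 * n := by exact_mod_cast (by omega : m + 1 < 2 * n)
      linarith
    have b1 := innerB_succ_left hn0 m
    have c1 := innerC_succ_left hn0 m
    have b2 := innerB_succ_left (Nat.succ_pos n) m
    have c2 := innerC_succ_left (Nat.succ_pos n) m
    have b3 := innerB_succ_left (Nat.succ_pos (n + 1)) m
    have c3 := innerC_succ_left (Nat.succ_pos (n + 1)) m
    have b' := innerB_succ_right hn0 m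
    have c' := innerC_succ_right hn0 m
    simp only [Nat.succ_eq_add_one, add_assoc, Nat.reduceAdd] at b2 c2 b3 c3
    push_cast at b2 c2 b3 c3
    have key := certificate_identity (b₂ := innerB (n + 2) m) (c₂ := innerC (n + 2) m)
      (b₃ := innerB (n + 3) m) (c₃ := innerC (n + 3) m) p0 p1 p2 p3 p4 p5 b1 c1
      (by linear_combination b2) (by linear_combination c2)
      (by linear_combination b3) (by linear_combination c3) b' c'
    rw [outerTerm_eq, outerTerm_add_one_eq, outerTerm_add_two_eq, outerTerm_add_three_eq,
      outerFactor_succ, Nat.cast_succ]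
    linear_combination outerFactor n m * key

theorem outerSum_recurrence_of_lt {n : ℕ} (hn : 1 ≤ n) (hn' : n < 5) :
    recurrenceCoeff0 (n : ℚ) * outerSum n + recurrenceCoeff1 (n : ℚ) * outerSum (n + 1) +
      recurrenceCoeff2 (n : ℚ) * outerSum (n + 2) +
      recurrenceCoeff3 (n : ℚ) * outerSum (n + 3) = 0 := by
  have a1 : outerSum 1 = 2 := by decide +kernel
  have a2 : outerSum 2 = 48 := by decide +kernel
  have a3 : outerSum 3 = 2288 := by decide +kernel
  have a4 : outerSum 4 = 135040 := by decide +kernel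
  have a5 : outerSum 5 = 8956752 := by decide +kernel
  have a6 : outerSum 6 = 640160976 := by decide +kernel
  have a7 : outerSum 7 = 48203722464 := by decide +kernel
  interval_cases n <;>
    norm_num [a1, a2, a3, a4, a5, a6, a7, recurrenceCoeff0, recurrenceCoeff1, recurrenceCoeff2,
      recurrenceCoeff3]

open Finset.HasAntidiagonal (antidiagonal mem_antidiagonal)

/-- `∑ c! / (k! l! (c-k-l)!) X k l`, the value at `(0, 0)` of the `c`-th power of one plus the two
shift operators applied to `X`. -/
def trinomialSum (c : ℕ) (X : ℕ → ℕ → ℕ) : ℕ :=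
  ∑ p ∈ antidiagonal c, c.choose p.1 * ∑ q ∈ antidiagonal p.2,
    p.2.choose q.1 * X p.1 q.1

theorem sum_antidiagonal_choose_succ (c : ℕ) (f : ℕ → ℕ → ℕ) :
    ∑ p ∈ antidiagonal (c + 1), (c + 1).choose p.1 * f p.1 p.2 =
      ∑ p ∈ antidiagonal c, c.choose p.1 * f p.1 (p.2 + 1) +
        ∑ p ∈ antidiagonal c, c.choose p.1 * f (p.1 + 1) p.2 := by
  have h := Finset.sum_antidiagonal_choose_succ_mul f c
  simp only [Nat.cast_id] at h
  rw [h]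
  congr 1
  refine Finset.sum_congr rfl fun p hp => ?_
  rw [Nat.choose_symm_of_eq_add (mem_antidiagonal.mp hp).symm]

theorem trinomialSum_zero (X : ℕ → ℕ → ℕ) : trinomialSum 0 X = X 0 0 := by
  simp [trinomialSum]

theorem trinomialSum_succ (c : ℕ) (X : ℕ → ℕ → ℕ) :
    trinomialSum (c + 1) X = trinomialSum c X + trinomialSum c (fun k l => X (k + 1) l) +
      trinomialSum c (fun k l => X k (l + 1)) := by
  have h (k m : ℕ) : ∑ q ∈ antidiagonal (m + 1), (m + 1).choose q.1 * X k q.1 = _ :=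
    sum_antidiagonal_choose_succ m fun l _ => X k l
  unfold trinomialSum
  rw [sum_antidiagonal_choose_succ c (fun k m => ∑ q ∈ antidiagonal m, m.choose q.1 * X k q.1)]
  simp only [h, mul_add, Finset.sum_add_distrib]
  ring

theorem trinomialSum_add (c : ℕ) (X Y : ℕ → ℕ → ℕ) :
    trinomialSum c (fun k l => X k l + Y k l) = trinomialSum c X + trinomialSum c Y := by
  simp only [trinomialSum, mul_add, Finset.sum_add_distrib]

theorem trinomialSum_swap (c : ℕ) (X : ℕ → ℕ → ℕ) :
    trinomialSum c (fun k l => X l k) = trinomialSum c X := by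
  induction c generalizing X with
  | zero => simp only [trinomialSum_zero]
  | succ c ih =>
    rw [trinomialSum_succ, trinomialSum_succ, ih, ih (fun k l => X k (l + 1)),
      ih (fun k l => X (k + 1) l)]
    ring

/-- The number of words with `c` occurrences of the letter `3` assembled from segments on either
side of that letter: `p` and `r` count families of inner segments below and above `3`, while `q`
and `s` count such families together with one final segment. -/
def assemble (c : ℕ) (p q r s : ℕ → ℕ) : ℕ :=
  trinomialSum c fun k l => p k * r l + q k * r l + p k * s l

theorem assemble_zero (p q r s : ℕ → ℕ) :
    assemble 0 p q r s = p 0 * r 0 + q 0 * r 0 + p 0 * s 0 :=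
  trinomialSum_zero _

theorem assemble_succ (c : ℕ) (p q r s : ℕ → ℕ) :
    assemble (c + 1) p q r s = assemble c p q r s +
      assemble c (fun k => p (k + 1)) (fun k => q (k + 1)) r s +
      assemble c p q (fun l => r (l + 1)) (fun l => s (l + 1)) :=
  trinomialSum_succ _ _

theorem assemble_add (c : ℕ) (p q p' q' r s : ℕ → ℕ) :
    assemble c (fun k => p k + p' k) (fun k => q k + q' k) r s =
      assemble c p q r s + assemble c p' q' r s := by
  unfold assemble
  rw [← trinomialSum_add]
  congr 1
  ext k l
  ring

theorem assemble_swap (c : ℕ) (p q r s : ℕ → ℕ) :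
    assemble c r s p q = assemble c p q r s := by
  unfold assemble
  rw [← trinomialSum_swap]
  congr 1
  ext k l
  ring

theorem assemble_zero_left (c : ℕ) (r s : ℕ → ℕ) :
    assemble c (fun _ => 0) (fun _ => 0) r s = 0 := by
  simp [assemble, trinomialSum]

/-- Families of `k` nonempty words in the letters `1`, `2` that start and end with `2`, with `a`
letters `1` and `b` letters `2` in total. -/
def closedFamilies : ℕ → ℕ → ℕ → ℕ
  | 0, a, 0 => if a = 0 then 1 else 0
  | _ + 1, _, 0 => 0
  | 0, _, _ + 1 => 0
  | k + 1, a, b + 1 => b.choose k * Nat.multichoose (b - k) a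

/-- Families as in `closedFamilies` with an additional word that is only required to end
with `2`. -/
def halfFamilies : ℕ → ℕ → ℕ → ℕ
  | _, _, 0 => 0
  | k, a, b + 1 => b.choose k * Nat.multichoose (b + 1 - k) a

/-- Families as in `halfFamilies` with an additional word that is only required to start
with `2`. -/
def openFamilies : ℕ → ℕ → ℕ → ℕ
  | _, _, 0 => 0
  | k, a, b + 1 => b.choose (k + 1) * Nat.multichoose (b + 1 - k) a

/-- Families of `k` words as in `closedFamilies`, preceded by a possibly empty continuation of a
word that has reached the letter `2`. -/
def tailFamilies (k a b : ℕ) : ℕ := b.choose k * Nat.multichoose (b - k) a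

/-- Families as in `tailFamilies` with an additional word that is only required to start
with `2`. -/
def openTailFamilies (k a b : ℕ) : ℕ := b.choose (k + 1) * Nat.multichoose (b - k) a

theorem choose_mul_multichoose_succ (b k j a : ℕ) (hj : k ≤ j) :
    b.choose j * Nat.multichoose (b + 1 - k) (a + 1) =
      b.choose j * Nat.multichoose (b - k) (a + 1) +
        b.choose j * Nat.multichoose (b + 1 - k) a := by
  rcases le_or_gt j b with h | h
  · rw [Nat.succ_sub (hj.trans h), Nat.multichoose_succ_succ]
    ring
  · simp [Nat.choose_eq_zero_of_lt h]

theorem halfFamilies_rec (k a b : ℕ) : halfFamilies k a b =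
    (if 0 < a then halfFamilies k (a - 1) b else 0) +
      if 0 < b then tailFamilies k a (b - 1) else 0 := by
  rcases b with _ | b <;> rcases a with _ | a <;> simp [halfFamilies, tailFamilies]
  rw [choose_mul_multichoose_succ b k k a le_rfl, add_comm]

theorem openFamilies_rec (k a b : ℕ) : openFamilies k a b =
    (if 0 < a then openFamilies k (a - 1) b else 0) +
      if 0 < b then openTailFamilies k a (b - 1) else 0 := by
  rcases b with _ | b <;> rcases a with _ | a <;> simp [openFamilies, openTailFamilies]
  rw [choose_mul_multichoose_succ b k (k + 1) a k.le_succ, add_comm]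

theorem tailFamilies_rec (k a b : ℕ) : tailFamilies k a b =
    (if 0 < a then halfFamilies k (a - 1) b else 0) +
      (if 0 < b then tailFamilies k a (b - 1) else 0) + closedFamilies k a b := by
  rcases b with _ | b <;> rcases a with _ | a <;> rcases k with _ | k <;>
    simp [halfFamilies, tailFamilies, closedFamilies, Nat.multichoose_succ_succ,
      Nat.choose_succ_succ]
  · ring
  · ring
  · have := choose_mul_multichoose_succ b (k + 1) (k + 1) a le_rfl
    rw [Nat.succ_sub_succ] at this
    linarith

theorem openTailFamilies_rec (k a b : ℕ) : openTailFamilies k a b =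
    (if 0 < a then openFamilies k (a - 1) b else 0) +
      (if 0 < b then openTailFamilies k a (b - 1) else 0) + halfFamilies k a b := by
  rcases b with _ | b <;> rcases a with _ | a <;>
    simp [halfFamilies, openFamilies, openTailFamilies, Nat.choose_succ_succ]
  · ring
  · have := choose_mul_multichoose_succ b k (k + 1) a k.le_succ
    linarith

theorem closedFamilies_succ (k a b : ℕ) : closedFamilies (k + 1) a b =
    if 0 < b then tailFamilies k a (b - 1) else 0 := by
  rcases b with _ | b <;> simp [closedFamilies, tailFamilies]

theorem halfFamilies_succ (k a b : ℕ) : halfFamilies (k + 1) a b =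
    if 0 < b then openTailFamilies k a (b - 1) else 0 := by
  rcases b with _ | b <;> simp [halfFamilies, openTailFamilies]

/-- The number of continuations, with prescribed content, of a word that has reached the
letter `3`. -/
def countFromThree (a b c d e : ℕ) : ℕ :=
  assemble c (closedFamilies · a b) (halfFamilies · a b) (closedFamilies · e d)
    (halfFamilies · e d)

/-- The number of continuations, with prescribed content, of a word that has reached the
letter `2`. -/
def countFromTwo (a b c d e : ℕ) : ℕ :=
  match c with
  | 0 => if d = 0 ∧ e = 0 then (a + b).choose a else 0
  | c + 1 => assemble c (tailFamilies · a b) (openTailFamilies · a b) (closedFamilies · e d)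
      (halfFamilies · e d)

/-- The number of continuations, with prescribed content, of a word that has reached the
letter `1`. -/
def countFromOne (a b c d e : ℕ) : ℕ :=
  match c with
  | 0 => if d = 0 ∧ e = 0 then (a + b).choose a else 0
  | c + 1 => assemble c (halfFamilies · a b) (openFamilies · a b) (closedFamilies · e d)
      (halfFamilies · e d)

theorem countFromThree_swap (a b c d e : ℕ) :
    countFromThree e d c b a = countFromThree a b c d e :=
  assemble_swap _ _ _ _ _

theorem assemble_ite (P : Prop) [Decidable P] (c : ℕ) (p q r s : ℕ → ℕ) :
    assemble c (fun k => if P then p k else 0) (fun k => if P then q k else 0) r s =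
      if P then assemble c p q r s else 0 := by
  split_ifs
  · rfl
  · exact assemble_zero_left c r s

theorem assemble_ite_right (P : Prop) [Decidable P] (c : ℕ) (p q r s : ℕ → ℕ) :
    assemble c p q (fun l => if P then r l else 0) (fun l => if P then s l else 0) =
      if P then assemble c r s p q else 0 :=
  (assemble_swap c _ _ _ _).trans (assemble_ite P c r s p q)

theorem countFromOne_rec {a b c d e : ℕ} (h : 0 < a + b + c + d + e) :
    countFromOne a b c d e = (if 0 < a then countFromOne (a - 1) b c d e else 0) +
      if 0 < b then countFromTwo a (b - 1) c d e else 0 := by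
  rcases c with _ | c
  · rcases a with _ | a <;> rcases b with _ | b <;> simp [countFromOne, countFromTwo]
    · omega
    · split_ifs
      · rw [show a + 1 + (b + 1) = (a + (b + 1)) + 1 by ring, Nat.choose_succ_succ,
          show a + (b + 1) = a + 1 + b by ring]
      · rfl
  · simp only [countFromOne, countFromTwo]
    rw [funext fun k => halfFamilies_rec k a b, funext fun k => openFamilies_rec k a b,
      assemble_add, assemble_ite, assemble_ite]

theorem countFromTwo_rec {a b c d e : ℕ} (h : 0 < a + b + c + d + e) :
    countFromTwo a b c d e = (if 0 < a then countFromOne (a - 1) b c d e else 0) +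
      (if 0 < b then countFromTwo a (b - 1) c d e else 0) +
      if 0 < c then countFromThree a b (c - 1) d e else 0 := by
  rcases c with _ | c
  · have := countFromOne_rec h
    simpa [countFromOne, countFromTwo] using this
  · simp only [countFromOne, countFromTwo, countFromThree, Nat.succ_pos, if_true,
      Nat.add_sub_cancel]
    rw [funext fun k => tailFamilies_rec k a b, funext fun k => openTailFamilies_rec k a b,
      assemble_add, assemble_add, assemble_ite, assemble_ite]

theorem countFromThree_rec {a b c d e : ℕ} (h : 0 < a + b + c + d + e) :
    countFromThree a b c d e = (if 0 < b then countFromTwo a (b - 1) c d e else 0) +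
      (if 0 < c then countFromThree a b (c - 1) d e else 0) +
      if 0 < d then countFromTwo e (d - 1) c b a else 0 := by
  rcases c with _ | c
  · rcases a with _ | a <;> rcases b with _ | b <;> rcases d with _ | d <;> rcases e with _ | e <;>
      simp [countFromTwo, countFromThree, assemble_zero, closedFamilies, halfFamilies,
        Nat.multichoose_eq] at h ⊢
    all_goals exact congrArg (Nat.choose · _) (by ring)
  · simp only [countFromTwo, countFromThree, Nat.succ_pos, if_true, Nat.add_sub_cancel]
    rw [assemble_succ]
    simp only [closedFamilies_succ, halfFamilies_succ]
    rw [assemble_ite, assemble_ite_right]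
    ring

/-- The number of continuations of a word ending with the given letter, with prescribed
content. -/
def countFrom (s : Fin 5) (a b c d e : ℕ) : ℕ :=
  match s with
  | 0 => countFromOne a b c d e
  | 1 => countFromTwo a b c d e
  | 2 => countFromThree a b c d e
  | 3 => countFromTwo e d c b a
  | 4 => countFromOne e d c b a

/-- The letters `s` and `t` differ by at most one. -/
def IsNear (s t : Fin 5) : Prop := |((s : ℕ) : ℤ) - ((t : ℕ) : ℤ)| ≤ 1

instance (s t : Fin 5) : Decidable (IsNear s t) := by unfold IsNear; infer_instance

theorem countFrom_rec (s : Fin 5) {c : Fin 5 → ℕ} {N : ℕ} (h : ∑ t, c t = N + 1) :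
    countFrom s (c 0) (c 1) (c 2) (c 3) (c 4) = ∑ t, if IsNear s t ∧ 0 < c t then
      (fun c' => countFrom t (c' 0) (c' 1) (c' 2) (c' 3) (c' 4)) (Function.update c t (c t - 1))
      else 0 := by
  have key : ∀ s t : Fin 5, IsNear s t ↔ s.val ≤ t.val + 1 ∧ t.val ≤ s.val + 1 := by decide
  rw [Fin.sum_univ_five] at h ⊢
  have h1 : 0 < c 0 + c 1 + c 2 + c 3 + c 4 := by omega
  have h2 : 0 < c 4 + c 3 + c 2 + c 1 + c 0 := by omega
  have r1 := countFromOne_rec h1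
  have r2 := countFromTwo_rec h1
  have r3 := countFromThree_rec h1
  have r4 := countFromTwo_rec h2
  have r5 := countFromOne_rec h2
  rw [countFromThree_swap] at r4
  fin_cases s
  · simpa [countFrom, key] using r1
  · simpa [countFrom, key] using r2
  · simpa [countFrom, key] using r3
  · simp [countFrom, key]
    linarith
  · simp [countFrom, key]
    linarith

/-- Any two consecutive entries of the word differ by at most one. -/
def IsPath {N : ℕ} (w : Fin N → Fin 5) : Prop :=
  ∀ j : Fin N, ∀ h : (j : ℕ) + 1 < N, IsNear (w j) (w ⟨(j : ℕ) + 1, h⟩)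

/-- The letter `k` occurs exactly `c k` times in the word, for all `k`. -/
def HasContent {N : ℕ} (c : Fin 5 → ℕ) (w : Fin N → Fin 5) : Prop :=
  ∀ k : Fin 5, (Finset.filter (fun j => w j = k) Finset.univ).card = c k

theorem isPath_cons {N : ℕ} (s : Fin 5) (v : Fin (N + 1) → Fin 5) :
    IsPath (Fin.cons s v : Fin (N + 2) → Fin 5) ↔ IsNear s (v 0) ∧ IsPath v := by
  have e (j : Fin (N + 1)) (h : (j.succ : ℕ) + 1 < N + 2) :
      (Fin.cons s v : Fin (N + 2) → Fin 5) ⟨(j.succ : ℕ) + 1, h⟩ =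
        v ⟨(j : ℕ) + 1, by simpa using h⟩ :=
    Fin.cons_succ (α := fun _ => Fin 5) s v ⟨(j : ℕ) + 1, Nat.succ_lt_succ_iff.mp h⟩
  have e0 (h : ((0 : Fin (N + 2)) : ℕ) + 1 < N + 2) :
      (Fin.cons s v : Fin (N + 2) → Fin 5) ⟨((0 : Fin (N + 2)) : ℕ) + 1, h⟩ = v 0 :=
    Fin.cons_succ (α := fun _ => Fin 5) s v 0
  unfold IsPath
  constructor
  · intro h
    refine ⟨?_, fun j hj => ?_⟩
    · have := h 0 (by simp)
      rwa [e0, Fin.cons_zero] at this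
    · have := h j.succ (by simpa using hj)
      rwa [e, Fin.cons_succ] at this
  · rintro ⟨h, h'⟩ j hj
    induction j using Fin.cases with
    | zero => rwa [e0, Fin.cons_zero]
    | succ j =>
      rw [e, Fin.cons_succ]
      exact h' j _

theorem isPath_cons_cons {N : ℕ} (s t : Fin 5) (w : Fin N → Fin 5) :
    IsPath (Fin.cons s (Fin.cons t w : Fin (N + 1) → Fin 5) : Fin (N + 2) → Fin 5) ↔
      IsNear s t ∧ IsPath (Fin.cons t w : Fin (N + 1) → Fin 5) := by
  rw [isPath_cons, Fin.cons_zero]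

theorem isPath_of_length_one (w : Fin 1 → Fin 5) : IsPath w :=
  fun j h => absurd h (by omega)

theorem hasContent_cons {N : ℕ} (c : Fin 5 → ℕ) (t : Fin 5) (w : Fin N → Fin 5) :
    HasContent c (Fin.cons t w : Fin (N + 1) → Fin 5) ↔
      0 < c t ∧ HasContent (Function.update c t (c t - 1)) w := by
  have h (k : Fin 5) :
      (Finset.filter (fun j => (Fin.cons t w : Fin (N + 1) → Fin 5) j = k) Finset.univ).card =
        if t = k then (Finset.filter (fun j => w j = k) Finset.univ).card + 1
        else (Finset.filter (fun j => w j = k) Finset.univ).card := by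
    rw [Fin.card_filter_univ_succ]
    simp
  simp only [HasContent, h]
  constructor
  · intro H
    refine ⟨?_, fun k => ?_⟩
    · have := H t
      rw [if_pos rfl] at this
      omega
    · have := H k
      rcases eq_or_ne t k with rfl | hk
      · rw [if_pos rfl] at this
        rw [Function.update_self]
        omega
      · rw [if_neg hk] at this
        rw [Function.update_of_ne hk.symm, this]
  · rintro ⟨H, H'⟩ k
    have := H' k
    rcases eq_or_ne t k with rfl | hk
    · rw [Function.update_self] at this
      rw [if_pos rfl]
      omega
    · rw [Function.update_of_ne hk.symm] at this
      rwa [if_neg hk]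

theorem card_words_succ {N : ℕ} (P : (Fin (N + 1) → Fin 5) → Prop) :
    Nat.card {w // P w} = ∑ t, Nat.card {w : Fin N → Fin 5 // P (Fin.cons t w)} := by
  rw [← Nat.card_sigma]
  exact Nat.card_congr
    { toFun := fun w => ⟨w.1 0, Fin.tail w.1, by rw [Fin.cons_self_tail]; exact w.2⟩
      invFun := fun x => ⟨Fin.cons x.1 x.2.1, x.2.2⟩
      left_inv := fun w => by simp
      right_inv := fun x => by rcases x with ⟨t, w, hw⟩; rfl }

theorem card_subtype_and {α : Type*} (Q : Prop) [Decidable Q] (P R : α → Prop)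
    (h : ∀ x, P x ↔ Q ∧ R x) : Nat.card {x // P x} = if Q then Nat.card {x // R x} else 0 := by
  split_ifs with hQ
  · exact Nat.card_congr (Equiv.subtypeEquivRight fun x => by simp [h, hQ])
  · have : IsEmpty {x // P x} := ⟨fun x => hQ ((h x.1).mp x.2).1⟩
    exact Nat.card_of_isEmpty

theorem card_paths_from (N : ℕ) (s : Fin 5) (c : Fin 5 → ℕ) (h : ∑ t, c t = N) :
    Nat.card {w : Fin N → Fin 5 //
      HasContent c w ∧ IsPath (Fin.cons s w : Fin (N + 1) → Fin 5)} =
      countFrom s (c 0) (c 1) (c 2) (c 3) (c 4) := by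
  induction N generalizing s c with
  | zero =>
    have hc : ∀ t, c t = 0 := by simpa using h
    have : countFrom s 0 0 0 0 0 = 1 := by
      fin_cases s <;> simp [countFrom, countFromOne, countFromTwo, countFromThree, assemble_zero,
        closedFamilies, halfFamilies]
    rw [hc, hc, hc, hc, hc, this, Nat.card_eq_one_iff_unique]
    exact ⟨inferInstance, ⟨Fin.elim0, fun k => by simp [hc], isPath_of_length_one _⟩⟩
  | succ N ih =>
    rw [card_words_succ, countFrom_rec s h]
    refine Finset.sum_congr rfl fun t _ => ?_
    rw [card_subtype_and (IsNear s t ∧ 0 < c t) _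
      (fun w => HasContent (Function.update c t (c t - 1)) w ∧
        IsPath (Fin.cons t w : Fin (N + 1) → Fin 5))
      fun w => by rw [isPath_cons_cons, hasContent_cons]; tauto]
    refine ite_congr rfl (fun ht => ih t _ ?_) fun _ => rfl
    have h1 := Finset.sum_update_of_mem (Finset.mem_univ t) c (c t - 1)
    have h2 := Finset.add_sum_erase Finset.univ c (Finset.mem_univ t)
    rw [Finset.sdiff_singleton_eq_erase] at h1
    omega

theorem card_paths {N : ℕ} {c : Fin 5 → ℕ} (h : ∑ t, c t = N + 1) :
    Nat.card {w : Fin (N + 1) → Fin 5 // HasContent c w ∧ IsPath w} = ∑ t, if 0 < c t then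
      (fun c' => countFrom t (c' 0) (c' 1) (c' 2) (c' 3) (c' 4)) (Function.update c t (c t - 1))
      else 0 := by
  rw [card_words_succ]
  refine Finset.sum_congr rfl fun t _ => ?_
  rw [card_subtype_and (0 < c t) _
    (fun w => HasContent (Function.update c t (c t - 1)) w ∧
      IsPath (Fin.cons t w : Fin (N + 1) → Fin 5))
    fun w => by rw [hasContent_cons]; tauto]
  refine ite_congr rfl (fun ht => card_paths_from N t _ ?_) fun _ => rfl
  have h1 := Finset.sum_update_of_mem (Finset.mem_univ t) c (c t - 1)
  have h2 := Finset.add_sum_erase Finset.univ c (Finset.mem_univ t)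
  rw [Finset.sdiff_singleton_eq_erase] at h1
  omega

theorem a177317_succ (N : ℕ) : a177317 (N + 1) = trinomialSum N fun k l =>
    closedFamilies k (N + 1) (N + 1) * closedFamilies l (N + 1) (N + 1) +
    2 * (halfFamilies k (N + 1) (N + 1) * closedFamilies l (N + 1) (N + 1)) +
    2 * (closedFamilies k (N + 1) (N + 1) * halfFamilies l (N + 1) (N + 1)) +
    2 * (halfFamilies k (N + 1) (N + 1) * halfFamilies l (N + 1) (N + 1)) +
    openFamilies k (N + 1) (N + 1) * closedFamilies l (N + 1) (N + 1) +
    closedFamilies k (N + 1) (N + 1) * openFamilies l (N + 1) (N + 1) := by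
  have h : a177317 (N + 1) = Nat.card {w : Fin (5 * N + 4 + 1) → Fin 5 //
      HasContent (fun _ => N + 1) w ∧ IsPath w} := rfl
  rw [h, card_paths (by simp; ring), Fin.sum_univ_five]
  have r1 := funext fun k => halfFamilies_rec k (N + 1) (N + 1)
  have r2 := funext fun k => openFamilies_rec k (N + 1) (N + 1)
  simp only [Nat.succ_pos, if_true, Nat.add_sub_cancel] at r1 r2
  have key := assemble_add N (halfFamilies · N (N + 1)) (openFamilies · N (N + 1))
    (tailFamilies · (N + 1) N) (openTailFamilies · (N + 1) N)
    (closedFamilies · (N + 1) (N + 1)) (halfFamilies · (N + 1) (N + 1))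
  rw [← r1, ← r2] at key
  simp [countFrom, countFromOne, countFromTwo, countFromThree]
  have sw := assemble_swap N (halfFamilies · (N + 1) (N + 1)) (openFamilies · (N + 1) (N + 1))
    (closedFamilies · (N + 1) (N + 1)) (halfFamilies · (N + 1) (N + 1))
  calc
    _ = assemble N (halfFamilies · (N + 1) (N + 1)) (openFamilies · (N + 1) (N + 1))
          (closedFamilies · (N + 1) (N + 1)) (halfFamilies · (N + 1) (N + 1)) +
        assemble N (closedFamilies · (N + 1) (N + 1)) (halfFamilies · (N + 1) (N + 1))
          (closedFamilies · (N + 1) (N + 1)) (halfFamilies · (N + 1) (N + 1)) +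
        assemble N (closedFamilies · (N + 1) (N + 1)) (halfFamilies · (N + 1) (N + 1))
          (halfFamilies · (N + 1) (N + 1)) (openFamilies · (N + 1) (N + 1)) := by linarith
    _ = _ := by
      unfold assemble
      rw [← trinomialSum_add, ← trinomialSum_add]
      congr 1
      ext k l
      ring

theorem cast_multichoose {N k : ℕ} (hk : k ≤ N) :
    (Nat.multichoose (N + 1 - k) (N + 1) : ℚ) =
      (2 * (N + 1) - k).choose (N + 1) * ((N + 1 - k) / (2 * (N + 1) - k)) := by
  obtain ⟨j, rfl⟩ := Nat.exists_eq_add_of_le hk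
  have h := cast_choose_mul_succ (k + 2 * j + 1) (k + j + 1)
  have p : (2 * ((k : ℚ) + j + 1) - k) ≠ 0 := by
    have : (0 : ℚ) < k + 2 * j + 2 := by positivity
    exact ne_of_gt (by linarith)
  rw [Nat.multichoose_eq, show k + j + 1 - k + (k + j + 1) - 1 = k + 2 * j + 1 by omega,
    show 2 * (k + j + 1) - k = k + 2 * j + 1 + 1 by omega]
  push_cast at h ⊢
  rw [mul_div_assoc', eq_div_iff p]
  linear_combination h

theorem cast_halfFamilies {N k : ℕ} (hk : k ≤ N) :
    (halfFamilies k (N + 1) (N + 1) : ℚ) = (N + 1).choose k * (2 * (N + 1) - k).choose (N + 1) *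
      ((N + 1 - k) ^ 2 / ((N + 1) * (2 * (N + 1) - k))) := by
  have h := cast_choose_eq_succ N k
  simp only [halfFamilies]
  push_cast
  rw [cast_multichoose hk, h]
  field_simp

theorem cast_openFamilies {N k : ℕ} (hk : k ≤ N) :
    (openFamilies k (N + 1) (N + 1) : ℚ) = (N + 1).choose k * (2 * (N + 1) - k).choose (N + 1) *
      ((N + 1 - k) ^ 2 * (N - k) / ((N + 1) * (2 * (N + 1) - k) * (k + 1))) := by
  have h := cast_choose_eq_succ N k
  have h' : (N.choose (k + 1) : ℚ) = N.choose k * ((N - k) / (k + 1)) := by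
    rw [mul_div_assoc', eq_div_iff (by positivity)]
    exact cast_choose_succ_right N k
  simp only [openFamilies]
  push_cast
  rw [cast_multichoose hk, h', h]
  field_simp

theorem cast_closedFamilies {N k : ℕ} (hk : k ≤ N) :
    (closedFamilies k (N + 1) (N + 1) : ℚ) =
      (N + 1).choose k * (2 * (N + 1) - k).choose (N + 1) *
        (k * (N + 1 - k) / ((N + 1) * (2 * (N + 1) - k))) := by
  rcases k with _ | k
  · simp [closedFamilies]
  · have h : (N.choose k : ℚ) = (N + 1).choose (k + 1) * ((k + 1) / (N + 1)) := by
      rw [mul_div_assoc', eq_div_iff (by positivity), cast_choose_succ_succ]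
      ring
    have h' := cast_multichoose hk
    rw [Nat.succ_sub_succ] at h'
    simp only [closedFamilies]
    push_cast at h' ⊢
    rw [h', h]
    field_simp

theorem sum_antidiagonal_choose_eq {N m : ℕ} (hm : m ≤ N) {F : ℕ → ℕ} {R : ℕ → ℚ}
    (h : ∀ l ≤ N, (F l : ℚ) = (N + 1).choose l * (2 * (N + 1) - l).choose (N + 1) * R l) :
    ∑ q ∈ antidiagonal m, (m.choose q.1 * F q.1 : ℚ) =
      ∑ l ∈ Finset.range (N + 1 + 1), innerTerm (N + 1) m l * R l := by
  rw [Finset.Nat.sum_antidiagonal_eq_sum_range_succ fun l _ => (m.choose l * F l : ℚ)]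
  rw [← Finset.sum_subset (Finset.range_subset_range.mpr (by omega : m + 1 ≤ N + 1 + 1))]
  · refine Finset.sum_congr rfl fun l hl => ?_
    rw [h l (by rw [Finset.mem_range] at hl; omega), innerTerm]
    ring
  · intro l _ hl
    rw [Finset.mem_range, not_lt] at hl
    rw [innerTerm, Nat.choose_eq_zero_of_lt (by omega)]
    simp

theorem sum_closedFamilies {N m : ℕ} (hm : m ≤ N) :
    ∑ q ∈ antidiagonal m, (m.choose q.1 * closedFamilies q.1 (N + 1) (N + 1) : ℚ) =
      innerB (N + 1) m := by
  rw [sum_antidiagonal_choose_eq hm fun l hl => cast_closedFamilies hl, innerB]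
  push_cast
  rfl

theorem sum_halfFamilies {N m : ℕ} (hm : m ≤ N) :
    ∑ q ∈ antidiagonal m, (m.choose q.1 * halfFamilies q.1 (N + 1) (N + 1) : ℚ) =
      innerC (N + 1) m := by
  rw [sum_antidiagonal_choose_eq hm fun l hl => cast_halfFamilies hl, innerC]
  push_cast
  rfl

theorem sum_openFamilies {N m : ℕ} (hm : m ≤ N) :
    ∑ q ∈ antidiagonal m, (m.choose q.1 * openFamilies q.1 (N + 1) (N + 1) : ℚ) =
      innerA (N + 1) m - innerB (N + 1) m - 2 * innerC (N + 1) m := by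
  rw [sum_antidiagonal_choose_eq hm fun l hl => cast_openFamilies hl, innerA, innerB, innerC,
    Finset.mul_sum, ← Finset.sum_sub_distrib, ← Finset.sum_sub_distrib]
  refine Finset.sum_congr rfl fun l hl => ?_
  obtain ⟨-, p, -⟩ := denominators_ne_zero (Nat.succ_pos N) (Finset.mem_range.mp hl)
  push_cast at p ⊢
  have p' : (2 * (N + 1) - l : ℚ) ≠ 0 := by rwa [mul_comm] at p
  field_simp
  ring

theorem outerTerm_eq_families {N k m : ℕ} (h : k + m = N) :
    (N.choose k * ((closedFamilies k (N + 1) (N + 1) + 2 * halfFamilies k (N + 1) (N + 1) +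
        openFamilies k (N + 1) (N + 1)) * innerB (N + 1) m +
      closedFamilies k (N + 1) (N + 1) * (innerA (N + 1) m - innerB (N + 1) m) +
      2 * halfFamilies k (N + 1) (N + 1) * innerC (N + 1) m) : ℚ) = outerTerm (N + 1) m := by
  have hk : k ≤ N := by omega
  have hA : innerA (N + 1) m = ((1 + m + (N + 1)) * innerB (N + 1) m +
      (1 + 2 * m + (N + 1)) * innerC (N + 1) m) / (m + 1) := by
    have := innerA_eq (Nat.succ_pos N) m
    rw [eq_div_iff (by positivity), mul_comm]
    simpa using this
  rw [cast_closedFamilies hk, cast_halfFamilies hk, cast_openFamilies hk, hA, outerTerm]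
  generalize innerB (N + 1) m = b
  generalize innerC (N + 1) m = c
  subst h
  have h1 := cast_choose_succ_right (k + m + 1) m
  have h2 := cast_choose_mul_succ (k + m + 1 + m) (k + m + 1)
  have h3 := cast_choose_mul_succ (k + m) m
  rw [Nat.choose_symm_of_eq_add (rfl : k + m = k + m),
    Nat.choose_symm_of_eq_add (by ring : k + m + 1 = k + (m + 1)),
    show 2 * (k + m + 1) - k = k + m + 1 + m + 1 by omega]
  push_cast at h1 h2 h3
  have e1 : ((k + m + 1).choose (m + 1) : ℚ) = (k + m + 1).choose m * ((k + 1) / (m + 1)) := by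
    rw [mul_div_assoc', eq_div_iff (by positivity)]
    linear_combination h1
  have e2 : ((k + m + 1 + m + 1).choose (k + m + 1) : ℚ) =
      (k + m + 1 + m).choose (k + m + 1) * ((k + 2 * m + 2) / (m + 1)) := by
    rw [mul_div_assoc', eq_div_iff (by positivity)]
    linear_combination -h2
  have e3 : ((k + m).choose m : ℚ) = (k + m + 1).choose m * ((k + 1) / (k + m + 1)) := by
    rw [mul_div_assoc', eq_div_iff (by positivity)]
    linear_combination h3
  rw [e1, e2, e3, outerRatio]
  push_cast
  rw [show (k + m + 1 - k : ℚ) = m + 1 by ring, show (k + m - k : ℚ) = m by ring,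
    show (2 * (k + m + 1) - k : ℚ) = k + 2 * m + 2 by ring]
  field_simp
  ring

theorem cast_a177317 {n : ℕ} (hn : 1 ≤ n) : (a177317 n : ℚ) = outerSum n := by
  obtain ⟨N, rfl⟩ := Nat.exists_eq_add_of_le' hn
  have h : outerSum (N + 1) = ∑ p ∈ antidiagonal N, outerTerm (N + 1) p.2 := by
    rw [outerSum, Finset.sum_range_succ, ← Finset.Nat.sum_antidiagonal_swap,
      Finset.Nat.sum_antidiagonal_eq_sum_range_succ_mk]
    simp [outerTerm, outerRatio]
  rw [a177317_succ, h, trinomialSum]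
  push_cast
  refine Finset.sum_congr rfl fun p hp => ?_
  have hp' := mem_antidiagonal.mp hp
  have hm : p.2 ≤ N := by omega
  rw [← outerTerm_eq_families hp']
  congr 1
  have hB := sum_closedFamilies hm
  have hC := sum_halfFamilies hm
  have hO := sum_openFamilies hm
  have hA : innerA (N + 1) p.2 = ∑ q ∈ antidiagonal p.2,
      (p.2.choose q.1 * openFamilies q.1 (N + 1) (N + 1) : ℚ) + innerB (N + 1) p.2 +
      2 * innerC (N + 1) p.2 := by rw [hO]; ring
  rw [hA, ← hB, ← hC]
  simp only [Finset.mul_sum, ← Finset.sum_add_distrib, ← Finset.sum_sub_distrib]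
  refine Finset.sum_congr rfl fun q _ => ?_
  ring

theorem cast_recurrence {n : ℕ} (hn : 1 ≤ n) :
    recurrenceCoeff0 (n : ℚ) * a177317 n + recurrenceCoeff1 (n : ℚ) * a177317 (n + 1) +
      recurrenceCoeff2 (n : ℚ) * a177317 (n + 2) +
      recurrenceCoeff3 (n : ℚ) * a177317 (n + 3) = 0 := by
  rw [cast_a177317 hn, cast_a177317 (by omega), cast_a177317 (by omega), cast_a177317 (by omega)]
  rcases le_or_gt 5 n with h | h
  · exact outerSum_recurrence h
  · exact outerSum_recurrence_of_lt hn h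

/-- The coefficients of the recurrence as polynomials over `ℤ`. -/
noncomputable def recurrencePolynomial : Fin 4 → Polynomial ℤ :=
  ![recurrenceCoeff0 Polynomial.X, recurrenceCoeff1 Polynomial.X,
    recurrenceCoeff2 Polynomial.X, recurrenceCoeff3 Polynomial.X]

theorem degree_recurrencePolynomial_le (i : Fin 4) : (recurrencePolynomial i).degree ≤ 14 := by
  fin_cases i
  · change (recurrenceCoeff0 (Polynomial.X : Polynomial ℤ)).degree ≤ 14
    unfold recurrenceCoeff0; compute_degree
  · change (recurrenceCoeff1 (Polynomial.X : Polynomial ℤ)).degree ≤ 14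
    unfold recurrenceCoeff1; compute_degree
  · change (recurrenceCoeff2 (Polynomial.X : Polynomial ℤ)).degree ≤ 14
    unfold recurrenceCoeff2; compute_degree
  · change (recurrenceCoeff3 (Polynomial.X : Polynomial ℤ)).degree ≤ 14
    unfold recurrenceCoeff3; compute_degree

theorem recurrencePolynomial_three_ne_zero : recurrencePolynomial 3 ≠ 0 := by
  intro h
  have h0 := congrArg (Polynomial.eval 0) h
  simp [recurrencePolynomial, recurrenceCoeff3] at h0

theorem cast_eval_recurrencePolynomial (x : ℤ) :
    (((recurrencePolynomial 0).eval x : ℤ) : ℚ) = recurrenceCoeff0 (x : ℚ) ∧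
    (((recurrencePolynomial 1).eval x : ℤ) : ℚ) = recurrenceCoeff1 (x : ℚ) ∧
    (((recurrencePolynomial 2).eval x : ℤ) : ℚ) = recurrenceCoeff2 (x : ℚ) ∧
    (((recurrencePolynomial 3).eval x : ℤ) : ℚ) = recurrenceCoeff3 (x : ℚ) := by
  refine ⟨?_, ?_, ?_, ?_⟩ <;>
    simp [recurrencePolynomial, recurrenceCoeff0, recurrenceCoeff1, recurrenceCoeff2,
      recurrenceCoeff3]

/-- There are polynomials `p₀, p₁, p₂, p₃ ∈ ℤ[x]`, each of degree at most `14`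
and with `p₃ ≠ 0`, such that
`p₀(n)·a(n) + p₁(n)·a(n+1) + p₂(n)·a(n+2) + p₃(n)·a(n+3) = 0` for all `n ≥ 1`;
in particular `a177317` is D-finite. -/
theorem stmt1 :
    ∃ p : Fin 4 → Polynomial ℤ,
      (∀ i, (p i).degree ≤ 14) ∧ p 3 ≠ 0 ∧
      ∀ n : ℕ, 1 ≤ n →
        ∑ i : Fin 4, (p i).eval (n : ℤ) * (a177317 (n + (i : ℕ)) : ℤ) = 0 := by
  refine ⟨recurrencePolynomial, degree_recurrencePolynomial_le,
    recurrencePolynomial_three_ne_zero, fun n hn => ?_⟩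
  obtain ⟨h0, h1, h2, h3⟩ := cast_eval_recurrencePolynomial n
  rw [← Int.cast_inj (α := ℚ), Fin.sum_univ_four]
  push_cast [h0, h1, h2, h3]
  simpa using cast_recurrence hn
end

section
/- There exist polynomials p0, …, p8 ∈ ℤ[x], each of degree at most 18 and with p8 ≠ 0, such that p0(n)·a(n) + p1(n)·a(n+1) + ⋯ + p8(n)·a(n+8) = 0 for all integers n ≥ 1. In particular, the sequence a is D-finite. -/
/-- `a199250 n` is the number of functions `A : {1,…,n} × {1,2} → {0,1,2,3}` such
that (i) no two horizontally or vertically adjacent entries are equal, (ii) the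
numbers of occurrences of any two values differ by at most `1`, and (iii) values
are introduced in row-major order (OEIS A199250). -/
noncomputable def a199250 (n : ℕ) : ℕ :=
  Nat.card {A : Fin n × Fin 2 → Fin 4 //
    (∀ i : Fin n, A (i, 0) ≠ A (i, 1)) ∧
    (∀ (i : Fin n) (j : Fin 2), ∀ h : (i : ℕ) + 1 < n,
      A (i, j) ≠ A (⟨(i : ℕ) + 1, h⟩, j)) ∧
    (∀ v w : Fin 4,
      (Finset.filter (fun p => A p = v) Finset.univ).card ≤
        (Finset.filter (fun p => A p = w) Finset.univ).card + 1) ∧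
    (∀ p : Fin n × Fin 2, 0 < (A p : ℕ) →
      ∃ q : Fin n × Fin 2,
        ((q.1 : ℕ) < (p.1 : ℕ) ∨ (q.1 = p.1 ∧ (q.2 : ℕ) < (p.2 : ℕ))) ∧
        (A q : ℕ) = (A p : ℕ) - 1)}

/-- The reciprocal factorial, extended by zero to the negative integers. -/
def invFactorial (z : ℤ) : ℚ := if z < 0 then 0 else 1 / (z.toNat.factorial : ℚ)

lemma invFactorial_natCast (n : ℕ) : invFactorial n = 1 / (n.factorial : ℚ) := by
  simp [invFactorial]

lemma invFactorial_of_neg {z : ℤ} (hz : z < 0) : invFactorial z = 0 := by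
  simp [invFactorial, hz]

lemma invFactorial_sub_one (z : ℤ) : invFactorial (z - 1) = z * invFactorial z := by
  rcases lt_trichotomy z 0 with hz | rfl | hz
  · rw [invFactorial_of_neg hz, invFactorial_of_neg (by omega), mul_zero]
  · rw [invFactorial_of_neg (by omega)]; simp
  · obtain ⟨n, rfl⟩ : ∃ n : ℕ, z = n + 1 := ⟨(z - 1).toNat, by omega⟩
    have h1 : ((n : ℤ) + 1) = ((n + 1 : ℕ) : ℤ) := by push_cast; ring
    rw [add_sub_cancel_right, h1, invFactorial_natCast, invFactorial_natCast, Nat.factorial_succ]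
    have := Nat.factorial_ne_zero n
    push_cast
    field_simp

/-- The sum `∑ₖ C(n,k)² C(2k,k)` (OEIS A002893). -/
def honeycomb (n : ℕ) : ℚ :=
  ∑ k ∈ Finset.range (n + 1), (n.choose k : ℚ) ^ 2 * k.centralBinom

lemma choose_eq_invFactorial (n k : ℕ) :
    (n.choose k : ℚ) = n.factorial * invFactorial (n - k) / k.factorial := by
  rcases le_or_gt k n with h | h
  · rw [Nat.cast_choose ℚ h, ← Nat.cast_sub h, invFactorial_natCast]
    have := Nat.factorial_ne_zero k
    have := Nat.factorial_ne_zero (n - k)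
    field_simp
  · rw [Nat.choose_eq_zero_of_lt h, invFactorial_of_neg (by omega)]
    simp

lemma honeycomb_eq_sum {n N : ℕ} (h : n < N) :
    honeycomb n = ∑ k ∈ Finset.range N, (n.choose k : ℚ) ^ 2 * k.centralBinom := by
  refine Finset.sum_subset (Finset.range_subset_range.2 h) fun k _ hk => ?_
  rw [Finset.mem_range, not_lt] at hk
  simp [Nat.choose_eq_zero_of_lt (Nat.lt_of_succ_le hk)]

lemma honeycomb_telescoping (n k : ℕ) :
    ∑ i ∈ Finset.range k,
      ((n + 2 : ℚ) ^ 2 * (((n + 2).choose i : ℚ) ^ 2 * i.centralBinom)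
        - (10 * n ^ 2 + 30 * n + 23) * (((n + 1).choose i : ℚ) ^ 2 * i.centralBinom)
        + 9 * (n + 1 : ℚ) ^ 2 * ((n.choose i : ℚ) ^ 2 * i.centralBinom)) =
      -(4 * n + 8 - 3 * k) * k ^ 3 * k.centralBinom
        * ((n + 1).factorial * invFactorial (n + 2 - k) / k.factorial) ^ 2 := by
  induction k with
  | zero => simp
  | succ k ih =>
    rw [Finset.sum_range_succ, ih]
    simp only [choose_eq_invFactorial]
    have e1 : (((n + 2 : ℕ) : ℤ) - k) = n + 2 - k := by push_cast; ring
    have e2 : invFactorial (((n + 1 : ℕ) : ℤ) - k) = (n + 2 - k) * invFactorial (n + 2 - k) := by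
      have := invFactorial_sub_one (n + 2 - k)
      push_cast at this ⊢
      rw [← this]; congr 1; ring
    have e3 : invFactorial ((n : ℤ) - k)
        = (n + 1 - k) * ((n + 2 - k) * invFactorial (n + 2 - k)) := by
      have := invFactorial_sub_one (((n + 1 : ℕ) : ℤ) - k)
      rw [← e2]
      push_cast at this ⊢
      rw [← this]; congr 1; ring
    have e4 : invFactorial ((n : ℤ) + 2 - (k + 1 : ℕ))
        = (n + 2 - k) * invFactorial (n + 2 - k) := by
      rw [← e2]; congr 1; push_cast; ring
    have e5 : ((k + 1).centralBinom : ℚ) = 2 * (2 * k + 1) * k.centralBinom / (k + 1) := by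
      rw [eq_div_iff (by positivity)]
      have := Nat.succ_mul_centralBinom_succ k
      have h : ((k + 1 : ℕ) : ℚ) * (k + 1).centralBinom = 2 * (2 * k + 1) * k.centralBinom := by
        exact_mod_cast this
      push_cast at h
      linear_combination h
    rw [e1, e2, e3, e4, e5]
    simp only [Nat.factorial_succ]
    have := Nat.factorial_ne_zero k
    push_cast
    field_simp
    ring

lemma honeycomb_recurrence (n : ℕ) :
    (n + 2 : ℚ) ^ 2 * honeycomb (n + 2) - (10 * n ^ 2 + 30 * n + 23) * honeycomb (n + 1)
      + 9 * (n + 1 : ℚ) ^ 2 * honeycomb n = 0 := by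
  have h := honeycomb_telescoping n (n + 3)
  rw [invFactorial_of_neg (by push_cast; omega), Finset.sum_add_distrib, Finset.sum_sub_distrib,
    ← Finset.mul_sum, ← Finset.mul_sum, ← Finset.mul_sum,
    ← honeycomb_eq_sum (by omega), ← honeycomb_eq_sum (by omega),
    ← honeycomb_eq_sum (by omega)] at h
  simpa using h

/-- The number of closed walks of length `2r` on the cubic lattice (OEIS A002896). -/
def cubicWalks (r : ℕ) : ℚ := r.centralBinom * honeycomb r

lemma cubicWalks_zero : cubicWalks 0 = 1 := by
  simp [cubicWalks, honeycomb]

lemma cubicWalks_one : cubicWalks 1 = 6 := by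
  norm_num [cubicWalks, honeycomb, Finset.sum_range_succ, Nat.centralBinom, Nat.choose]

lemma cubicWalks_recurrence (r : ℕ) :
    (r + 2 : ℚ) ^ 3 * cubicWalks (r + 2)
      - 2 * (2 * r + 3) * (10 * (r + 1) ^ 2 + 10 * (r + 1) + 3) * cubicWalks (r + 1)
      + 36 * (r + 1) * (4 * (r + 1) ^ 2 - 1) * cubicWalks r = 0 := by
  have e (k : ℕ) :
      (k + 1 : ℚ) * (k + 1).centralBinom = 2 * (2 * k + 1) * k.centralBinom := by
    exact_mod_cast Nat.succ_mul_centralBinom_succ k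
  have h1 := e r
  have h2 := e (r + 1)
  have h := honeycomb_recurrence r
  push_cast at h2
  unfold cubicWalks
  linear_combination (r + 2 : ℚ) ^ 2 * honeycomb (r + 2) * h2
    + 2 * (2 * r + 3) * (r + 1).centralBinom * h
    - 18 * (2 * r + 3) * (r + 1) * honeycomb r * h1

/-- The coefficient of `z ^ r` in the `m`-th term of the polynomial sequence with
`V₀ = 1`, `V₁ = z + 7`, `Vₘ₊₂ = (z + 14) Vₘ₊₁ - 49 Vₘ`. -/
def ladderCoeff (m r : ℕ) : ℕ := (m + r).choose (2 * r) * 7 ^ (m - r)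

lemma ladderCoeff_of_lt {m r : ℕ} (h : m < r) : ladderCoeff m r = 0 := by
  simp [ladderCoeff, Nat.choose_eq_zero_of_lt (show m + r < 2 * r by omega)]

lemma ladderCoeff_eq (m r : ℕ) :
    (ladderCoeff m r : ℚ)
      = (m + r).factorial * invFactorial (m - r) / (2 * r).factorial * 7 ^ (m - r : ℤ) := by
  rcases le_or_gt r m with h | h
  · rw [ladderCoeff, Nat.cast_mul, choose_eq_invFactorial, ← Nat.cast_sub h, zpow_natCast]
    congr 3
    · congr 2; push_cast; omega
    · push_cast; rfl
  · rw [ladderCoeff_of_lt h, invFactorial_of_neg (by omega)]; simp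

/-- The sum of the walk numbers weighted by `ladderCoeff m`. -/
def ladderSum (m : ℕ) : ℚ := ∑ r ∈ Finset.range (m + 1), ladderCoeff m r * cubicWalks r

lemma ladderSum_eq_sum {m N : ℕ} (h : m < N) :
    ladderSum m = ∑ r ∈ Finset.range N, ladderCoeff m r * cubicWalks r := by
  refine Finset.sum_subset (Finset.range_subset_range.2 h) fun k _ hk => ?_
  rw [Finset.mem_range, not_lt] at hk
  simp [ladderCoeff_of_lt (Nat.lt_of_succ_le hk)]

/-- The multiplier of the recurrence of `cubicWalks` that telescopes the recurrence of
`ladderSum`. -/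
def ladderMultiplier (m r : ℕ) : ℚ :=
  2 * 7 ^ (m + 3 - r : ℤ) * (2 * m + 3) * (2 * m + 5) * (2 * m + 7) * (m + 2) * (m + 3)
    * (m + r + 1).factorial * invFactorial (m + 3 - r) / (2 * r + 1).factorial

/-- The operator of order four annihilating `ladderSum`, applied to a sequence at `m`. -/
def ladderOperator (u : ℕ → ℚ) (m : ℕ) : ℚ :=
  2401 * (m + 1) ^ 3 * (2 * m + 7) * (m + 3) * u m
  - (6664 * m ^ 5 + 73304 * m ^ 4 + 309386 * m ^ 3 + 627200 * m ^ 2 + 615440 * m + 235641)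
      * u (m + 1)
  + (1996 * m ^ 5 + 24950 * m ^ 4 + 121576 * m ^ 3 + 288070 * m ^ 2 + 331546 * m + 148365)
      * u (m + 2)
  - (136 * m ^ 5 + 1904 * m ^ 4 + 10394 * m ^ 3 + 27510 * m ^ 2 + 35110 * m + 17241)
      * u (m + 3)
  + (m + 4) ^ 3 * (2 * m + 3) * (m + 2) * u (m + 4)

lemma ladderOperator_ladderCoeff_zero (m : ℕ) :
    ladderOperator (fun i => ladderCoeff i 0) m
      = -6 * ladderMultiplier m 0 + 108 * ladderMultiplier m 1 := by
  have e : invFactorial (m + 3 - 1) = (m + 3) * invFactorial (m + 3) := by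
    rw [invFactorial_sub_one]; push_cast; ring
  have e0 : invFactorial (m + 3) = 1 / (m + 3).factorial := by
    rw [← invFactorial_natCast]; push_cast; rfl
  have h7 : (7 : ℚ) ^ ((m : ℤ) + 3) = 343 * 7 ^ m := by
    rw [zpow_add₀ (by norm_num), zpow_natCast]; norm_num; ring
  have h7' : (7 : ℚ) ^ ((m : ℤ) + 3 - 1) = 49 * 7 ^ m := by
    rw [zpow_sub₀ (by norm_num), h7]; norm_num; ring
  simp only [ladderMultiplier, ladderOperator, ladderCoeff, Nat.cast_zero, Nat.cast_one, sub_zero,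
    e, e0, h7, h7']
  have := Nat.factorial_ne_zero m
  simp only [Nat.factorial_succ, Nat.mul_zero, Nat.mul_one, Nat.add_zero, Nat.choose_zero_right,
    Nat.sub_zero, pow_succ, Nat.factorial_zero]
  push_cast
  field_simp
  ring

lemma ladderOperator_ladderCoeff_succ (m r : ℕ) :
    ladderOperator (fun i => ladderCoeff i (r + 1)) m
      = (r + 1) ^ 3 * ladderMultiplier m r
        - 2 * (2 * r + 3) * (10 * (r + 1) ^ 2 + 10 * (r + 1) + 3) * ladderMultiplier m (r + 1)
        + 36 * (r + 2) * (4 * (r + 2) ^ 2 - 1) * ladderMultiplier m (r + 2) := by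
  obtain ⟨d, hd⟩ : ∃ d : ℤ, d = m - r := ⟨_, rfl⟩
  have hdq : (d : ℚ) = m - r := by rw [hd]; push_cast; rfl
  have s3 : (m : ℤ) + 3 - r = d + 3 := by omega
  have i2 : invFactorial (d + 2) = (d + 3) * invFactorial (d + 3) := by
    have := invFactorial_sub_one (d + 3)
    push_cast at this
    rw [← this]; congr 1; ring
  have i1 : invFactorial (d + 1) = (d + 2) * ((d + 3) * invFactorial (d + 3)) := by
    have := invFactorial_sub_one (d + 2)
    push_cast at this
    rw [← i2, ← this]; congr 1; ring
  have i0 : invFactorial d = (d + 1) * ((d + 2) * ((d + 3) * invFactorial (d + 3))) := by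
    have := invFactorial_sub_one (d + 1)
    push_cast at this
    rw [← i1, ← this]; congr 1; ring
  have im : invFactorial (d - 1)
      = d * ((d + 1) * ((d + 2) * ((d + 3) * invFactorial (d + 3)))) := by
    rw [invFactorial_sub_one, i0]
  have z (k : ℤ) : (7 : ℚ) ^ (d + k) = 7 ^ d * 7 ^ k := zpow_add₀ (by norm_num) _ _
  have z1 : (7 : ℚ) ^ (d - 1) = 7 ^ d / 7 := by rw [zpow_sub₀ (by norm_num), zpow_one]
  have f2 (k : ℕ) : (((2 * (k + 1)).factorial : ℕ) : ℚ)
      = (2 * k + 2) * ((2 * k + 1) * (2 * k).factorial) := by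
    rw [show 2 * (k + 1) = 2 * k + 1 + 1 by ring, Nat.factorial_succ, Nat.factorial_succ]
    push_cast; ring
  have a0 : (m : ℤ) - (r + 1 : ℕ) = d - 1 := by push_cast; omega
  have a1 : ((m + 1 : ℕ) : ℤ) - (r + 1 : ℕ) = d := by push_cast; omega
  have a2 : ((m + 2 : ℕ) : ℤ) - (r + 1 : ℕ) = d + 1 := by push_cast; omega
  have a3 : ((m + 3 : ℕ) : ℤ) - (r + 1 : ℕ) = d + 2 := by push_cast; omega
  have a4 : ((m + 4 : ℕ) : ℤ) - (r + 1 : ℕ) = d + 3 := by push_cast; omega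
  have b1 : (m : ℤ) + 3 - (r + 1 : ℕ) = d + 2 := by push_cast; omega
  have b2 : (m : ℤ) + 3 - (r + 2 : ℕ) = d + 1 := by push_cast; omega
  simp only [ladderMultiplier, ladderOperator, ladderCoeff_eq, a0, a1, a2, a3, a4, b1, b2, s3,
    im, i0, i1, i2, z, z1]
  rw [show m + (r + 1) = m + r + 1 by ring, show m + 1 + (r + 1) = m + r + 1 + 1 by ring,
    show m + 2 + (r + 1) = m + r + 1 + 1 + 1 by ring,
    show m + 3 + (r + 1) = m + r + 1 + 1 + 1 + 1 by ring,
    show m + 4 + (r + 1) = m + r + 1 + 1 + 1 + 1 + 1 by ring,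
    show m + (r + 2) + 1 = m + r + 1 + 1 + 1 by ring, show r + 2 = r + 1 + 1 by ring]
  simp only [Nat.factorial_succ, Nat.cast_mul, f2]
  have := Nat.factorial_ne_zero (m + r)
  have := Nat.factorial_ne_zero (2 * r)
  have h7 : (7 : ℚ) ^ d ≠ 0 := by positivity
  rw [hdq]
  generalize invFactorial (d + 3) = Z
  generalize (7 : ℚ) ^ d = W at *
  push_cast
  field_simp
  ring

lemma sum_ladderOperator (m N : ℕ) :
    ∑ r ∈ Finset.range (N + 1), ladderOperator (fun i => ladderCoeff i r) m * cubicWalks r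
      = -(N + 1) ^ 3 * ladderMultiplier m N * cubicWalks (N + 1)
        + 36 * (N + 1) * (4 * (N + 1) ^ 2 - 1) * ladderMultiplier m (N + 1) * cubicWalks N := by
  induction N with
  | zero =>
    simp only [zero_add, Finset.sum_range_one, ladderOperator_ladderCoeff_zero, cubicWalks_zero,
      cubicWalks_one]
    push_cast
    ring
  | succ N ih =>
    rw [Finset.sum_range_succ, ih, ladderOperator_ladderCoeff_succ]
    push_cast
    linear_combination ladderMultiplier m (N + 1) * cubicWalks_recurrence N

theorem ladderSum_recurrence (m : ℕ) : ladderOperator ladderSum m = 0 := by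
  have h := sum_ladderOperator m (m + 4)
  have h1 : ladderMultiplier m (m + 4) = 0 := by
    rw [ladderMultiplier, invFactorial_of_neg (by push_cast; omega), mul_zero, zero_div]
  have h2 : ladderMultiplier m (m + 4 + 1) = 0 := by
    rw [ladderMultiplier, invFactorial_of_neg (by push_cast; omega), mul_zero, zero_div]
  rw [h1, h2] at h
  simp only [mul_zero, zero_mul, add_zero] at h
  rw [← h]
  simp only [ladderOperator]
  rw [ladderSum_eq_sum (show m < m + 4 + 1 by omega),
    ladderSum_eq_sum (show m + 1 < m + 4 + 1 by omega),
    ladderSum_eq_sum (show m + 2 < m + 4 + 1 by omega),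
    ladderSum_eq_sum (show m + 3 < m + 4 + 1 by omega),
    ladderSum_eq_sum (show m + 4 < m + 4 + 1 by omega)]
  simp only [Finset.mul_sum, ← Finset.sum_add_distrib, ← Finset.sum_sub_distrib]
  refine Finset.sum_congr rfl fun r _ => ?_
  ring

section TransferMatrix

variable {R : Type*} [CommRing R]

lemma ladderCoeff_add_two (m r : ℕ) :
    ladderCoeff (m + 2) (r + 1) + 49 * ladderCoeff m (r + 1)
      = ladderCoeff (m + 1) r + 14 * ladderCoeff (m + 1) (r + 1) := by
  have e0 : (m : ℤ) - (r + 1 : ℕ) = m - r - 1 := by push_cast; ring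
  have e1 : ((m + 1 : ℕ) : ℤ) - (r + 1 : ℕ) = m - r := by push_cast; ring
  have e2 : ((m + 2 : ℕ) : ℤ) - (r + 1 : ℕ) = m - r + 1 := by push_cast; ring
  have e3 : ((m + 1 : ℕ) : ℤ) - r = m - r + 1 := by push_cast; ring
  have i1 : invFactorial (m - r) = (m - r + 1) * invFactorial (m - r + 1) := by
    have := invFactorial_sub_one (m - r + 1)
    rw [add_sub_cancel_right] at this
    rw [this]; push_cast; ring
  have z1 : (7 : ℚ) ^ ((m : ℤ) - r + 1) = 7 ^ ((m : ℤ) - r) * 7 := zpow_add_one₀ (by norm_num) _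
  have z0 : (7 : ℚ) ^ ((m : ℤ) - r - 1) = 7 ^ ((m : ℤ) - r) / 7 := by
    rw [zpow_sub₀ (by norm_num), zpow_one]
  have h : ((ladderCoeff (m + 2) (r + 1) : ℚ) + 49 * ladderCoeff m (r + 1))
      = ladderCoeff (m + 1) r + 14 * ladderCoeff (m + 1) (r + 1) := by
    simp only [ladderCoeff_eq, e0, e1, e2, e3, invFactorial_sub_one ((m : ℤ) - r), i1, z0, z1]
    rw [show m + 2 + (r + 1) = m + r + 1 + 1 + 1 by ring, show m + (r + 1) = m + r + 1 by ring,
      show m + 1 + r = m + r + 1 by ring, show m + 1 + (r + 1) = m + r + 1 + 1 by ring,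
      show 2 * (r + 1) = 2 * r + 1 + 1 by ring]
    simp only [Nat.factorial_succ]
    have := Nat.factorial_ne_zero (2 * r)
    push_cast
    field_simp
    ring
  exact_mod_cast h

/-- The polynomial sequence with `V₀ = 1`, `V₁ = z + 7`, `Vₘ₊₂ = (z + 14) Vₘ₊₁ - 49 Vₘ`. -/
def ladderPoly (z : R) : ℕ → R
  | 0 => 1
  | 1 => z + 7
  | m + 2 => (z + 14) * ladderPoly z (m + 1) - 49 * ladderPoly z m

lemma ladderPoly_eq_sum_aux (z : R) (N m : ℕ) (h : m ≤ N) :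
    ladderPoly z m = ∑ r ∈ Finset.range (N + 1), (ladderCoeff m r : R) * z ^ r := by
  induction m using Nat.strong_induction_on with
  | _ m ih =>
    match m with
    | 0 =>
      rw [Finset.sum_range_succ', Finset.sum_eq_zero]
      · simp [ladderPoly, ladderCoeff]
      · intro r _
        simp [ladderCoeff_of_lt (Nat.succ_pos r)]
    | 1 =>
      obtain ⟨N, rfl⟩ : ∃ K, N = K + 1 := ⟨N - 1, by omega⟩
      rw [Finset.sum_range_succ', Finset.sum_range_succ', Finset.sum_eq_zero]
      · simp [ladderPoly, ladderCoeff]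
      · intro r _
        simp [ladderCoeff_of_lt (show 1 < r + 1 + 1 by omega)]
    | m + 2 =>
      have h1 := ih (m + 1) (by omega) (by omega)
      have h0 := ih m (by omega) (by omega)
      have hz : z * ladderPoly z (m + 1)
          = ∑ r ∈ Finset.range N, (ladderCoeff (m + 1) r : R) * z ^ (r + 1) := by
        rw [h1, Finset.sum_range_succ, ladderCoeff_of_lt (show m + 1 < N by omega), Nat.cast_zero,
          zero_mul, add_zero, Finset.mul_sum]
        exact Finset.sum_congr rfl fun r _ => by ring
      rw [ladderPoly, add_mul, hz, h1, h0, Finset.sum_range_succ', Finset.sum_range_succ',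
        Finset.sum_range_succ']
      have hs : ∑ r ∈ Finset.range N, (ladderCoeff (m + 2) (r + 1) : R) * z ^ (r + 1)
          = ∑ r ∈ Finset.range N, (ladderCoeff (m + 1) r : R) * z ^ (r + 1)
            + 14 * ∑ r ∈ Finset.range N, (ladderCoeff (m + 1) (r + 1) : R) * z ^ (r + 1)
            - 49 * ∑ r ∈ Finset.range N, (ladderCoeff m (r + 1) : R) * z ^ (r + 1) := by
        simp only [Finset.mul_sum, ← Finset.sum_add_distrib, ← Finset.sum_sub_distrib]
        refine Finset.sum_congr rfl fun r _ => ?_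
        have := congrArg (Nat.cast (R := R)) (ladderCoeff_add_two m r)
        push_cast at this
        linear_combination z ^ (r + 1) * this
      have hc (k : ℕ) : (ladderCoeff k 0 : R) = 7 ^ k := by simp [ladderCoeff]
      rw [hs, hc, hc, hc]
      ring

lemma ladderPoly_eq_sum (z : R) (m : ℕ) :
    ladderPoly z m = ∑ r ∈ Finset.range (m + 1), (ladderCoeff m r : R) * z ^ r :=
  ladderPoly_eq_sum_aux z m m le_rfl

/-- The weight of a column, zero if its two entries agree. -/
def columnWeight (x : Fin 4 → R) (s : Fin 4 × Fin 4) : R :=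
  if s.1 = s.2 then 0 else x s.1 * x s.2

/-- The indicator of two columns being allowed next to each other. -/
def columnAdj (R : Type*) [CommRing R] (s t : Fin 4 × Fin 4) : R :=
  if s.1 ≠ t.1 ∧ s.2 ≠ t.2 then 1 else 0

/-- The total weight of the proper colourings with `n + 1` columns, the first being `s`. -/
def ladderWeight (x : Fin 4 → R) : ℕ → Fin 4 × Fin 4 → R
  | 0, s => columnWeight x s
  | n + 1, s => columnWeight x s * ∑ t, columnAdj R s t * ladderWeight x n t

/-- The second elementary symmetric function of the weights. -/
def pairSum (x : Fin 4 → R) : R :=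
  x 0 * x 1 + x 0 * x 2 + x 0 * x 3 + x 1 * x 2 + x 1 * x 3 + x 2 * x 3

/-- The total weight of the proper colourings with `n + 1` columns whose first column is
increasing. -/
def halfWeight (x : Fin 4 → R) (n : ℕ) : R :=
  ladderWeight x n (0, 1) + ladderWeight x n (0, 2) + ladderWeight x n (0, 3)
    + ladderWeight x n (1, 2) + ladderWeight x n (1, 3) + ladderWeight x n (2, 3)

lemma ladderWeight_diag (x : Fin 4 → R) (n : ℕ) (i : Fin 4) : ladderWeight x n (i, i) = 0 := by
  cases n <;> simp [ladderWeight, columnWeight]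

lemma columnWeight_swap (x : Fin 4 → R) (i j : Fin 4) :
    columnWeight x (i, j) = columnWeight x (j, i) := by
  simp only [columnWeight, eq_comm (a := i), mul_comm (x i)]

lemma ladderWeight_swap (x : Fin 4 → R) (n : ℕ) (i j : Fin 4) :
    ladderWeight x n (i, j) = ladderWeight x n (j, i) := by
  induction n generalizing i j with
  | zero => exact columnWeight_swap x i j
  | succ n ih =>
    rw [ladderWeight, ladderWeight, columnWeight_swap, ← (Equiv.prodComm _ _).sum_comp]
    congr 1
    refine Finset.sum_congr rfl fun t _ => ?_
    rw [Equiv.prodComm_apply, Prod.swap, ih]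
    simp only [columnAdj, and_comm]

lemma sum_ladderWeight (x : Fin 4 → R) (n : ℕ) :
    ∑ s, ladderWeight x n s = 2 * halfWeight x n := by
  simp only [Fintype.sum_prod_type, Fin.sum_univ_four, ladderWeight_diag, halfWeight,
    ladderWeight_swap x n 1 0, ladderWeight_swap x n 2 0, ladderWeight_swap x n 3 0,
    ladderWeight_swap x n 2 1, ladderWeight_swap x n 3 1, ladderWeight_swap x n 3 2]
  ring

lemma ladderWeight_succ (x : Fin 4 → R) (n : ℕ) :
    ladderWeight x (n + 1) (0, 1) = x 0 * x 1 * (halfWeight x n + ladderWeight x n (2, 3)) ∧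
    ladderWeight x (n + 1) (0, 2) = x 0 * x 2 * (halfWeight x n + ladderWeight x n (1, 3)) ∧
    ladderWeight x (n + 1) (0, 3) = x 0 * x 3 * (halfWeight x n + ladderWeight x n (1, 2)) ∧
    ladderWeight x (n + 1) (1, 2) = x 1 * x 2 * (halfWeight x n + ladderWeight x n (0, 3)) ∧
    ladderWeight x (n + 1) (1, 3) = x 1 * x 3 * (halfWeight x n + ladderWeight x n (0, 2)) ∧
    ladderWeight x (n + 1) (2, 3) = x 2 * x 3 * (halfWeight x n + ladderWeight x n (0, 1)) := by
  refine ⟨?_, ?_, ?_, ?_, ?_, ?_⟩ <;>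
  · simp [ladderWeight, Fintype.sum_prod_type, Fin.sum_univ_four, ladderWeight_diag, halfWeight,
      columnWeight, columnAdj,
      ladderWeight_swap x n 1 0, ladderWeight_swap x n 2 0, ladderWeight_swap x n 3 0,
      ladderWeight_swap x n 2 1, ladderWeight_swap x n 3 1, ladderWeight_swap x n 3 2]
    ring

lemma halfWeight_zero (x : Fin 4 → R) : halfWeight x 0 = pairSum x := by
  simp [halfWeight, pairSum, ladderWeight, columnWeight]

lemma halfWeight_succ (x : Fin 4 → R) (n : ℕ) :
    halfWeight x (n + 1) = pairSum x * halfWeight x n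
      + (x 0 * x 1 * ladderWeight x n (2, 3) + x 0 * x 2 * ladderWeight x n (1, 3)
      + x 0 * x 3 * ladderWeight x n (1, 2) + x 1 * x 2 * ladderWeight x n (0, 3)
      + x 1 * x 3 * ladderWeight x n (0, 2) + x 2 * x 3 * ladderWeight x n (0, 1)) := by
  obtain ⟨h1, h2, h3, h4, h5, h6⟩ := ladderWeight_succ x n
  rw [halfWeight, h1, h2, h3, h4, h5, h6, pairSum]
  ring

lemma halfWeight_one (x : Fin 4 → R) (hx : x 0 * x 1 * x 2 * x 3 = 1) :
    halfWeight x 1 = pairSum x ^ 2 + 6 := by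
  rw [← zero_add 1, halfWeight_succ, halfWeight_zero]
  simp [ladderWeight, columnWeight]
  linear_combination 6 * hx

lemma halfWeight_add_two (x : Fin 4 → R) (hx : x 0 * x 1 * x 2 * x 3 = 1) (n : ℕ) :
    halfWeight x (n + 2) = pairSum x * halfWeight x (n + 1) + 7 * halfWeight x n := by
  obtain ⟨h1, h2, h3, h4, h5, h6⟩ := ladderWeight_succ x n
  rw [halfWeight_succ, h1, h2, h3, h4, h5, h6]
  have h : halfWeight x n = ladderWeight x n (0, 1) + ladderWeight x n (0, 2)
    + ladderWeight x n (0, 3) + ladderWeight x n (1, 2) + ladderWeight x n (1, 3)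
    + ladderWeight x n (2, 3) := rfl
  linear_combination (7 * halfWeight x n) * hx - x 0 * x 1 * x 2 * x 3 * h

lemma halfWeight_odd (x : Fin 4 → R) (hx : x 0 * x 1 * x 2 * x 3 = 1) (m : ℕ) :
    halfWeight x (2 * m + 1)
      = ladderPoly (pairSum x ^ 2) (m + 1) - ladderPoly (pairSum x ^ 2) m := by
  induction m using Nat.strong_induction_on with
  | _ m ih =>
    match m with
    | 0 =>
      rw [Nat.mul_zero, zero_add, halfWeight_one x hx]
      simp only [ladderPoly]; ring
    | 1 =>
      have e0 := halfWeight_add_two x hx 0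
      have e1 := halfWeight_add_two x hx 1
      rw [zero_add, zero_add, halfWeight_one x hx, halfWeight_zero] at e0
      rw [e0, halfWeight_one x hx] at e1
      rw [show 2 * 1 + 1 = 1 + 2 by rfl, e1]
      simp only [ladderPoly]; ring
    | m + 2 =>
      have h0 := ih m (by omega)
      have h1 := ih (m + 1) (by omega)
      have e1 := halfWeight_add_two x hx (2 * m + 1)
      have e2 := halfWeight_add_two x hx (2 * m + 2)
      have e3 := halfWeight_add_two x hx (2 * m + 3)
      rw [show 2 * (m + 2) + 1 = 2 * m + 3 + 2 by ring, e3]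
      rw [show 2 * (m + 1) + 1 = 2 * m + 3 by ring] at h1
      rw [show 2 * m + 1 + 2 = 2 * m + 3 by ring, show 2 * m + 1 + 1 = 2 * m + 2 by ring] at e1
      rw [show 2 * m + 2 + 2 = 2 * m + 3 + 1 by ring, show 2 * m + 2 + 1 = 2 * m + 3 by ring] at e2
      rw [show m + 2 + 1 = m + 1 + 2 by ring]
      simp only [ladderPoly] at h1 ⊢
      linear_combination pairSum x * e2 - 7 * e1 + (pairSum x ^ 2 + 14) * h1 - 49 * h0

lemma pairSum_mul_halfWeight (x : Fin 4 → R) (hx : x 0 * x 1 * x 2 * x 3 = 1) (m : ℕ) :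
    pairSum x * halfWeight x (2 * m + 2) = ladderPoly (pairSum x ^ 2) (m + 2)
      - 8 * ladderPoly (pairSum x ^ 2) (m + 1) + 7 * ladderPoly (pairSum x ^ 2) m := by
  have e := halfWeight_add_two x hx (2 * m + 1)
  have h0 := halfWeight_odd x hx m
  have h1 := halfWeight_odd x hx (m + 1)
  rw [show 2 * (m + 1) + 1 = 2 * m + 1 + 2 by ring] at h1
  rw [show 2 * m + 1 + 1 = 2 * m + 2 by ring] at e
  linear_combination h1 - e - 7 * h0

end TransferMatrix

section ConstantTerm

open AddMonoidAlgebra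

/-- The ring of Laurent polynomials in three variables. -/
abbrev Laurent : Type := AddMonoidAlgebra ℤ (ℤ × ℤ × ℤ)

/-- The constant term of a Laurent polynomial. -/
def constantTerm : Laurent →+ ℤ where
  toFun f := f.coeff 0
  map_zero' := rfl
  map_add' _ _ := rfl

lemma constantTerm_single (a : ℤ × ℤ × ℤ) (b : ℤ) :
    constantTerm (single a b) = if a = 0 then b else 0 := by
  change (single a b).coeff 0 = _
  rw [coeff_single, Finsupp.single_apply]

/-- The exponents of the monomials standing for the four colours. -/
def colourExponent : Fin 4 → ℤ × ℤ × ℤ := ![(1, 1, 0), (1, -1, 0), (-1, 0, 1), (-1, 0, -1)]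

/-- The monomials standing for the four colours; their product is `1`. -/
noncomputable def colourMonomial (c : Fin 4) : Laurent := single (colourExponent c) 1

lemma prod_colourMonomial :
    colourMonomial 0 * colourMonomial 1 * colourMonomial 2 * colourMonomial 3 = 1 := by
  simp [colourMonomial, colourExponent, one_def]
  rfl

lemma pairSum_colourMonomial :
    pairSum colourMonomial
      = (single (0, 1, 0) 1 + single (-(0, 1, 0)) 1)
          * (single (0, 0, 1) 1 + single (-(0, 0, 1)) 1)
        + (single (2, 0, 0) 1 + single (-(2, 0, 0)) 1) := by
  simp [pairSum, colourMonomial, colourExponent, add_mul, mul_add]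
  abel

lemma single_add_single_neg_pow (a : ℤ × ℤ × ℤ) (n : ℕ) :
    (single a 1 + single (-a) 1 : Laurent) ^ n
      = ∑ k ∈ Finset.range (n + 1), single ((2 * k - n : ℤ) • a) (n.choose k : ℤ) := by
  rw [add_pow]
  refine Finset.sum_congr rfl fun k hk => ?_
  have hk : k ≤ n := Nat.lt_succ_iff.1 (Finset.mem_range.1 hk)
  rw [single_pow, single_pow, single_mul_single, ← nsmul_eq_mul', ← Nat.cast_smul_eq_nsmul ℤ,
    smul_single]
  congr 1
  · rw [← natCast_zsmul, ← natCast_zsmul, smul_neg, ← sub_eq_add_neg, ← sub_smul]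
    congr 1
    push_cast [hk]
    ring
  · simp

/-- The number of closed walks of length `n` on the line. -/
def lineWalks (n : ℕ) : ℤ :=
  ∑ k ∈ Finset.range (n + 1), if 2 * k = n then (n.choose k : ℤ) else 0

lemma lineWalks_even (k : ℕ) : lineWalks (2 * k) = k.centralBinom := by
  rw [lineWalks, Finset.sum_eq_single k]
  · simp [Nat.centralBinom]
  · intro b _ hb
    rw [if_neg (by omega)]
  · intro h
    simp at h
    omega

lemma lineWalks_odd (k : ℕ) : lineWalks (2 * k + 1) = 0 :=
  Finset.sum_eq_zero fun i _ => if_neg (by omega)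

lemma constantTerm_pow_mul (i j : ℕ) :
    constantTerm (((single (0, 1, 0) 1 + single (-(0, 1, 0)) 1)
        * (single (0, 0, 1) 1 + single (-(0, 0, 1)) 1)) ^ i
        * (single (2, 0, 0) 1 + single (-(2, 0, 0)) 1) ^ j)
      = lineWalks i * lineWalks i * lineWalks j := by
  rw [mul_pow, single_add_single_neg_pow, single_add_single_neg_pow, single_add_single_neg_pow]
  simp only [lineWalks, Finset.sum_mul_sum, map_sum]
  simp only [Finset.sum_mul, map_sum, single_mul_single, constantTerm_single]
  refine Finset.sum_congr rfl fun a _ => Finset.sum_congr rfl fun b _ =>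
    Finset.sum_congr rfl fun c _ => ?_
  simp only [Prod.smul_mk, smul_eq_mul, mul_zero, mul_one, Prod.mk_add_mk, zero_add, add_zero,
    Prod.mk_eq_zero]
  split_ifs <;> omega

lemma sum_range_two_mul_add_one {M : Type*} [AddCommMonoid M] (f : ℕ → M)
    (hf : ∀ k, f (2 * k + 1) = 0) (n : ℕ) :
    ∑ k ∈ Finset.range (2 * n + 1), f k = ∑ k ∈ Finset.range (n + 1), f (2 * k) := by
  induction n with
  | zero => simp
  | succ n ih =>
    rw [show 2 * (n + 1) + 1 = 2 * n + 1 + 1 + 1 by ring, Finset.sum_range_succ,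
      Finset.sum_range_succ, ih, hf, add_zero, Finset.sum_range_succ _ (n + 1)]
    rfl

lemma choose_mul_centralBinom {r k : ℕ} (h : k ≤ r) :
    (2 * r).choose (2 * k) * k.centralBinom * (r - k).centralBinom
      = r.centralBinom * r.choose k ^ 2 := by
  obtain ⟨d, rfl⟩ := Nat.exists_eq_add_of_le h
  have e (n : ℕ) : (n.centralBinom : ℚ) = (2 * n).factorial / (n.factorial * n.factorial) := by
    rw [Nat.centralBinom, Nat.cast_choose ℚ (by omega), show 2 * n - n = n by omega]
  have : (((2 * (k + d)).choose (2 * k) * k.centralBinom * (k + d - k).centralBinom : ℕ) : ℚ)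
      = ((k + d).centralBinom * (k + d).choose k ^ 2 : ℕ) := by
    push_cast
    rw [e, e, e, Nat.cast_choose ℚ (by omega), Nat.cast_choose ℚ (by omega),
      show 2 * (k + d) - 2 * k = 2 * d by omega, show k + d - k = d by omega]
    have := Nat.factorial_ne_zero k
    have := Nat.factorial_ne_zero d
    have := Nat.factorial_ne_zero (2 * k)
    have := Nat.factorial_ne_zero (2 * d)
    have := Nat.factorial_ne_zero (k + d)
    field_simp
  exact_mod_cast this

lemma constantTerm_pairSum_pow (r : ℕ) :
    (constantTerm ((pairSum colourMonomial ^ 2) ^ r) : ℚ) = cubicWalks r := by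
  rw [← pow_mul, pairSum_colourMonomial, add_pow, map_sum]
  have h (i : ℕ) : constantTerm (((single (0, 1, 0) 1 + single (-(0, 1, 0)) 1)
        * (single (0, 0, 1) 1 + single (-(0, 0, 1)) 1)) ^ i
        * (single (2, 0, 0) 1 + single (-(2, 0, 0)) 1) ^ (2 * r - i) * ((2 * r).choose i : Laurent))
      = (2 * r).choose i * (lineWalks i * lineWalks i * lineWalks (2 * r - i)) := by
    rw [← nsmul_eq_mul', map_nsmul, constantTerm_pow_mul, nsmul_eq_mul]
  simp only [h]
  rw [sum_range_two_mul_add_one _ (by intro k; simp [lineWalks_odd]), cubicWalks, honeycomb,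
    Finset.mul_sum]
  push_cast
  refine Finset.sum_congr rfl fun k hk => ?_
  have hk : k ≤ r := Nat.lt_succ_iff.1 (Finset.mem_range.1 hk)
  rw [show 2 * r - 2 * k = 2 * (r - k) by omega, lineWalks_even, lineWalks_even]
  have := congrArg (Nat.cast (R := ℚ)) (choose_mul_centralBinom hk)
  push_cast at this ⊢
  linear_combination (k.centralBinom : ℚ) * this

lemma constantTerm_ladderPoly (m : ℕ) :
    (constantTerm (ladderPoly (pairSum colourMonomial ^ 2) m) : ℚ) = ladderSum m := by
  rw [ladderPoly_eq_sum, map_sum, ladderSum]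
  push_cast
  refine Finset.sum_congr rfl fun r _ => ?_
  rw [← nsmul_eq_mul, map_nsmul, nsmul_eq_mul]
  push_cast
  rw [constantTerm_pairSum_pow]

end ConstantTerm

section Counting

variable {R : Type*} [CommRing R]

/-- The transfer-matrix weight of a sequence of columns. -/
def pathWeight (x : Fin 4 → R) {n : ℕ} (c : Fin (n + 1) → Fin 4 × Fin 4) : R :=
  (∏ i, columnWeight x (c i)) * ∏ i : Fin n, columnAdj R (c i.castSucc) (c i.succ)

lemma pathWeight_cons (x : Fin 4 → R) {n : ℕ} (s : Fin 4 × Fin 4)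
    (c : Fin (n + 1) → Fin 4 × Fin 4) :
    pathWeight x (Fin.cons s c : Fin (n + 2) → Fin 4 × Fin 4)
      = columnWeight x s * (columnAdj R s (c 0) * pathWeight x c) := by
  let d : Fin (n + 2) → Fin 4 × Fin 4 := Fin.cons s c
  change (∏ i, columnWeight x (d i)) * ∏ i : Fin (n + 1), columnAdj R (d i.castSucc) (d i.succ) = _
  rw [pathWeight, Fin.prod_univ_succ fun i => columnWeight x (d i),
    Fin.prod_univ_succ fun i : Fin (n + 1) => columnAdj R (d i.castSucc) (d i.succ)]
  simp only [d, Fin.cons_succ, Fin.cons_zero, Fin.castSucc_zero, ← Fin.succ_castSucc]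
  ring

lemma sum_mul_pathWeight (x : Fin 4 → R) (n : ℕ) (f : Fin 4 × Fin 4 → R) :
    ∑ c : Fin (n + 1) → Fin 4 × Fin 4, f (c 0) * pathWeight x c
      = ∑ s, f s * ladderWeight x n s := by
  induction n generalizing f with
  | zero =>
    rw [← (Equiv.funUnique (Fin 1) (Fin 4 × Fin 4)).symm.sum_comp]
    exact Finset.sum_congr rfl fun s _ => by simp [pathWeight, ladderWeight]
  | succ n ih =>
    rw [← (Fin.consEquiv fun _ : Fin (n + 2) => Fin 4 × Fin 4).sum_comp, Fintype.sum_prod_type]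
    refine Finset.sum_congr rfl fun s _ => ?_
    rw [ladderWeight, ← ih, Finset.mul_sum, Finset.mul_sum]
    refine Finset.sum_congr rfl fun c _ => ?_
    change f s * pathWeight x (Fin.cons s c : Fin (n + 2) → Fin 4 × Fin 4) = _
    rw [pathWeight_cons]

/-- No two adjacent entries are equal. -/
def IsProper {n : ℕ} (A : Fin n × Fin 2 → Fin 4) : Prop :=
  (∀ i : Fin n, A (i, 0) ≠ A (i, 1)) ∧
    ∀ (i : Fin n) (j : Fin 2), ∀ h : (i : ℕ) + 1 < n, A (i, j) ≠ A (⟨(i : ℕ) + 1, h⟩, j)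

/-- The number of occurrences of a value. -/
def colourCount {n : ℕ} (A : Fin n × Fin 2 → Fin 4) (v : Fin 4) : ℕ :=
  (Finset.filter (fun p => A p = v) Finset.univ).card

/-- The numbers of occurrences of any two values differ by at most one. -/
def IsBalanced {n : ℕ} (A : Fin n × Fin 2 → Fin 4) : Prop :=
  ∀ v w : Fin 4, colourCount A v ≤ colourCount A w + 1

lemma sum_colourCount {n : ℕ} (A : Fin n × Fin 2 → Fin 4) : ∑ v, colourCount A v = 2 * n := by
  have := Finset.card_eq_sum_card_fiberwise (f := A) (s := Finset.univ) (t := Finset.univ)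
    fun _ _ => Finset.mem_coe.2 (Finset.mem_univ _)
  rw [Finset.card_univ, Fintype.card_prod, Fintype.card_fin, Fintype.card_fin] at this
  rw [mul_comm, this]
  rfl

lemma prod_comp_colouring (x : Fin 4 → R) {n : ℕ} (A : Fin n × Fin 2 → Fin 4) :
    ∏ p, x (A p) = ∏ v, x v ^ colourCount A v := by
  rw [← Finset.prod_fiberwise' Finset.univ A x]
  exact Finset.prod_congr rfl fun v _ => Finset.prod_const _

open Classical in
lemma pathWeight_columns (x : Fin 4 → R) {n : ℕ} (A : Fin (n + 1) × Fin 2 → Fin 4) :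
    pathWeight x (fun i => (A (i, 0), A (i, 1)))
      = if IsProper A then ∏ v, x v ^ colourCount A v else 0 := by
  split_ifs with h
  · rw [← prod_comp_colouring, pathWeight, Finset.prod_eq_one (f := fun i : Fin n => _), mul_one,
      Fintype.prod_prod_type]
    · refine Finset.prod_congr rfl fun i _ => ?_
      rw [columnWeight, if_neg (h.1 i), Fin.prod_univ_two]
    · intro i _
      exact if_pos ⟨h.2 i.castSucc 0 (by simp), h.2 i.castSucc 1 (by simp)⟩
  · rw [IsProper, not_and_or] at h
    push Not at h
    rcases h with ⟨i, hi⟩ | ⟨i, j, hi, hj⟩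
    · have h0 : columnWeight x (A (i, 0), A (i, 1)) = 0 := if_pos hi
      exact mul_eq_zero_of_left (Finset.prod_eq_zero (Finset.mem_univ i) h0) _
    · refine mul_eq_zero_of_right _ (Finset.prod_eq_zero (i := (⟨i, by omega⟩ : Fin n))
        (Finset.mem_univ _) (if_neg fun h => ?_))
      fin_cases j
      · exact h.1 hj
      · exact h.2 hj

open Classical in
lemma sum_proper (x : Fin 4 → R) (n : ℕ) :
    ∑ A : Fin (n + 1) × Fin 2 → Fin 4, (if IsProper A then ∏ v, x v ^ colourCount A v else 0)
      = 2 * halfWeight x n := by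
  have := sum_mul_pathWeight x n fun _ => 1
  simp only [one_mul] at this
  rw [← sum_ladderWeight, ← this]
  let e : (Fin (n + 1) × Fin 2 → Fin 4) ≃ (Fin (n + 1) → Fin 4 × Fin 4) :=
    (Equiv.curry _ _ _).trans (Equiv.piCongrRight fun _ => finTwoArrowEquiv _)
  rw [← e.sum_comp]
  exact Finset.sum_congr rfl fun A _ => (pathWeight_columns x A).symm

open AddMonoidAlgebra

lemma constantTerm_prod (k : Fin 4 → ℕ) :
    constantTerm (∏ v, colourMonomial v ^ k v)
      = if k 0 = k 1 ∧ k 1 = k 2 ∧ k 2 = k 3 then 1 else 0 := by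
  simp only [Fin.prod_univ_four, colourMonomial, colourExponent, single_pow, single_mul_single,
    one_pow, mul_one, constantTerm_single]
  refine if_congr ?_ rfl rfl
  simp [Prod.ext_iff]
  omega

lemma constantTerm_prod_of_sum {k : Fin 4 → ℕ} {m : ℕ} (hk : ∑ v, k v = 4 * m) :
    constantTerm (∏ v, colourMonomial v ^ k v)
      = if (∀ v w, k v ≤ k w + 1) then 1 else 0 := by
  rw [constantTerm_prod]
  refine if_congr ?_ rfl rfl
  rw [Fin.sum_univ_four] at hk
  simp only [Fin.forall_fin_succ, IsEmpty.forall_iff, and_true]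
  simp only [Fin.succ_zero_eq_one, Fin.reduceSucc]
  omega

lemma constantTerm_pairSum_mul_prod_of_sum {k : Fin 4 → ℕ} {m : ℕ} (hk : ∑ v, k v = 4 * m + 2) :
    constantTerm (pairSum colourMonomial * ∏ v, colourMonomial v ^ k v)
      = if (∀ v w, k v ≤ k w + 1) then 1 else 0 := by
  have h (a b c d : ℕ) : constantTerm (colourMonomial 0 ^ a * colourMonomial 1 ^ b
      * colourMonomial 2 ^ c * colourMonomial 3 ^ d) = if a = b ∧ b = c ∧ c = d then 1 else 0 := by
    have := constantTerm_prod ![a, b, c, d]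
    rw [Fin.prod_univ_four] at this
    exact this
  have e : pairSum colourMonomial * ∏ v, colourMonomial v ^ k v =
      colourMonomial 0 ^ (k 0 + 1) * colourMonomial 1 ^ (k 1 + 1)
        * colourMonomial 2 ^ k 2 * colourMonomial 3 ^ k 3
      + colourMonomial 0 ^ (k 0 + 1) * colourMonomial 1 ^ k 1
        * colourMonomial 2 ^ (k 2 + 1) * colourMonomial 3 ^ k 3
      + colourMonomial 0 ^ (k 0 + 1) * colourMonomial 1 ^ k 1
        * colourMonomial 2 ^ k 2 * colourMonomial 3 ^ (k 3 + 1)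
      + colourMonomial 0 ^ k 0 * colourMonomial 1 ^ (k 1 + 1)
        * colourMonomial 2 ^ (k 2 + 1) * colourMonomial 3 ^ k 3
      + colourMonomial 0 ^ k 0 * colourMonomial 1 ^ (k 1 + 1)
        * colourMonomial 2 ^ k 2 * colourMonomial 3 ^ (k 3 + 1)
      + colourMonomial 0 ^ k 0 * colourMonomial 1 ^ k 1
        * colourMonomial 2 ^ (k 2 + 1) * colourMonomial 3 ^ (k 3 + 1) := by
    rw [pairSum, Fin.prod_univ_four]
    ring
  rw [e]
  simp only [map_add, h]
  have hb : (∀ v w, k v ≤ k w + 1) ↔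
      ((k 0 ≤ k 1 + 1 ∧ k 0 ≤ k 2 + 1 ∧ k 0 ≤ k 3 + 1) ∧
      (k 1 ≤ k 0 + 1 ∧ k 1 ≤ k 2 + 1 ∧ k 1 ≤ k 3 + 1) ∧
      (k 2 ≤ k 0 + 1 ∧ k 2 ≤ k 1 + 1 ∧ k 2 ≤ k 3 + 1) ∧
      (k 3 ≤ k 0 + 1 ∧ k 3 ≤ k 1 + 1 ∧ k 3 ≤ k 2 + 1)) := by
    simp [Fin.forall_fin_succ]
  simp only [hb]
  rw [Fin.sum_univ_four] at hk
  split_ifs <;> omega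

open Classical in
/-- The number of proper balanced colourings with `n` columns. -/
noncomputable def balancedCount (n : ℕ) : ℕ :=
  (Finset.filter (fun A : Fin n × Fin 2 → Fin 4 => IsProper A ∧ IsBalanced A) Finset.univ).card

lemma balancedCount_even (m : ℕ) :
    (balancedCount (2 * m + 2) : ℚ) = 2 * (ladderSum (m + 1) - ladderSum m) := by
  classical
  have h := congrArg constantTerm (sum_proper colourMonomial (2 * m + 1))
  have e (p : Laurent) : 2 * p = 2 • p := by rw [two_mul, two_nsmul]
  rw [halfWeight_odd _ prod_colourMonomial, e, map_nsmul, map_sub, map_sum] at h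
  rw [← constantTerm_ladderPoly, ← constantTerm_ladderPoly, ← Int.cast_natCast]
  refine ((congrArg (Int.cast (R := ℚ)) (Eq.trans ?_ h))).trans (by simp)
  rw [balancedCount, Finset.card_filter]
  push_cast
  refine Finset.sum_congr rfl fun A _ => ?_
  rw [apply_ite constantTerm, map_zero, constantTerm_prod_of_sum (m := m + 1)
    (by rw [sum_colourCount]; ring), ← ite_and]
  exact if_congr Iff.rfl rfl rfl

lemma balancedCount_odd (m : ℕ) :
    (balancedCount (2 * m + 3) : ℚ)
      = 2 * (ladderSum (m + 2) - 8 * ladderSum (m + 1) + 7 * ladderSum m) := by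
  classical
  have h := congrArg (fun y => constantTerm (pairSum colourMonomial * y))
    (sum_proper colourMonomial (2 * m + 2))
  have e : pairSum colourMonomial * (2 * halfWeight colourMonomial (2 * m + 2))
      = 2 • (pairSum colourMonomial * halfWeight colourMonomial (2 * m + 2)) := by
    rw [two_nsmul]; ring
  have e' (p q r : Laurent) : p - 8 * q + 7 * r = p - 8 • q + 7 • r := by
    simp [nsmul_eq_mul]
  simp only [e, pairSum_mul_halfWeight _ prod_colourMonomial, e', map_nsmul, map_add, map_sub,
    Finset.mul_sum, map_sum] at h
  simp only [← constantTerm_ladderPoly]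
  rw [← Int.cast_natCast]
  refine ((congrArg (Int.cast (R := ℚ)) (Eq.trans ?_ h))).trans (by simp)
  rw [balancedCount, Finset.card_filter]
  push_cast
  refine Finset.sum_congr rfl fun A _ => ?_
  rw [mul_ite, mul_zero, apply_ite constantTerm, map_zero,
    constantTerm_pairSum_mul_prod_of_sum (m := m + 1) (by rw [sum_colourCount]; ring), ← ite_and]
  exact if_congr Iff.rfl rfl rfl

end Counting

section Recurrence

open Polynomial

/-- The polynomial with the given list of coefficients, constant coefficient first. -/
noncomputable def listPoly (l : List ℤ) : ℤ[X] := l.foldr (fun c q => C c + X * q) 0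

lemma degree_listPoly_le {l : List ℤ} {n : ℕ} (h : l.length ≤ n + 1) :
    (listPoly l).degree ≤ n := by
  rw [degree_le_iff_coeff_zero]
  intro m hm
  replace hm : l.length ≤ m := h.trans (Nat.succ_le_of_lt (WithBot.coe_lt_coe.1 hm))
  clear h
  induction l generalizing m with
  | nil => simp [listPoly]
  | cons c l ih =>
    obtain ⟨m, rfl⟩ := Nat.exists_eq_add_of_le' (Nat.one_le_of_lt hm)
    change (C c + X * listPoly l).coeff (m + 1) = 0
    rw [coeff_add, coeff_C_succ, coeff_X_mul, ih m (Nat.le_of_succ_le_succ hm), add_zero]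

/-- The value at `x` of the polynomial with the given list of coefficients. -/
def hornerEval (l : List ℤ) (x : ℚ) : ℚ := l.foldr (fun (c : ℤ) (q : ℚ) => c + x * q) 0

lemma eval_listPoly (l : List ℤ) (n : ℤ) : (((listPoly l).eval n : ℤ) : ℚ) = hornerEval l n := by
  induction l with
  | nil => simp [listPoly, hornerEval]
  | cons c l ih =>
    have e : listPoly (c :: l) = C c + X * listPoly l := rfl
    rw [e, eval_add, eval_mul, eval_C, eval_X, Int.cast_add, Int.cast_mul, ih]
    rfl

/-- The coefficients of the polynomials in the recurrence, constant coefficients first. -/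
def recurrenceCoeffs : Fin 9 → List ℤ :=
  ![[-284550123424250880, -152221962633705216, 1953293176998375072, 825387494118058956,
  -4377145304608153602, -1531691863732332785, 3687167387358496825, 1874636032219416480,
  -1101816275157737636, -1029743555072675786, -124856361804631254, 148615391772769684,
  85610543026134238, 23116169417001507, 3779369413445157, 393362117066520, 25558250467680,
  946494944640, 15247310400],
    [-40650017632035840, -21745994661957888, 279041882428339296, -167733643437340512,
    -569058106180796400, 818224766738992816, 1827345013464555536, 933946047688343312,
    -159184048602139120, -387942736306004656, -203286413550576496, -59366032840609712,
    -11007829606994976, -1330223827994880, -102014699109120, -4524773460480, -88621102080],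
    [-550099808046673920, -493737090006545280, 3663667135898856464, 3222468548785199560,
    -8188156676033235636, -8645202930136839990, 5123427309069437508, 10514527456144694416,
    4189527794090441656, -1446667823646091676, -2174426144258623528, -1070009039073417576,
    -312665096842041860, -60555061700403774, -8002900921097964, -715869944989920,
    -41507532037440, -1407476407680, -21159532800],
    [302899389156983808, 1183489735641276672, 638900100019013280, -6117063052562103264,
    -14633385307522669968, -13600678843094790160, -4543101599062164880, 2095886346169322448,
    3022090263943176048, 1611710136429240848, 524674321420351984, 115050379265915408,
    17436374740988448, 1809697800922368, 123180620693760, 4963973414400, 89881021440],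
    [2241632726631383040, -1707822499913975808, -14330051008111536640, 1253966571679120544,
    26292041422805986916, 16559982023796783464, -6630539742099178338, -11372250923283480432,
    -4106531283480692472, 701710206462103888, 1209622715721976332, 543127159571100928,
    143733661544146916, 25368689206384776, 3081580236625926, 255598187043600, 13860578401920,
    443270862720, 6337699200],
    [414880086726484992, -703565592690564864, -3304388405799296096, 1656692969442164192,
    8887580052512569840, 7485798844601180176, 1419240810305748464, -1700988421119160528,
    -1532537108526979600, -653114205020504080, -177057060077400720, -32897630654855440,
    -4269489097098720, -382425909655296, -22608427495680, -795731074560, -12648545280],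
    [-386361105430487040, 362966203871922816, 2585247822637176528, -436246371740000968,
    -5127979899901075012, -3602644645400336362, 476542029868395028, 1654700191172187312,
    774756137411805464, 65356607456018524, -83335880571170760, -44782390785194264,
    -12136573570938452, -2109073745816418, -248323488379356, -19816874857440, -1030245647040,
    -31543585920, -431827200],
    [-11994992293118976, 19465948673978112, 92563942542274912, -45154188162475680,
    -239090404741385328, -195069828231353008, -32206686153402480, 46781333788387824,
    39772269834318992, 16381221910217904, 4303230420196368, 774006938048176, 97011662710752,
    8365228776192, 474295069440, 15943150080, 240952320],
    [9022856001408000, -8975552722937856, -60714271411152768, 12487904697136788,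
    122274660900741270, 85009382983192745, -9937647259042095, -37168790585750896,
    -17708593419639092, -2010947384958022, 1450802141371066, 819274134660588, 219624053692822,
    37238653201653, 4251360995997, 327706813080, 16411906080, 483114240, 6350400]]

set_option maxRecDepth 10000 in
lemma sum_recurrence_even (u : ℕ → ℚ) (hu : ∀ m, ladderOperator u m = 0) (a : ℕ → ℚ)
    (he : ∀ m, 12 * a (2 * m + 2) = u (m + 1) - u m)
    (ho : ∀ m, 12 * a (2 * m + 3) = u (m + 2) - 8 * u (m + 1) + 7 * u m) (k : ℕ) :
    ∑ i : Fin 9, hornerEval (recurrenceCoeffs i) (2 * k + 2) * a (2 * k + 2 + i) = 0 := by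
  have h0 := hu k
  have h1 := hu (k + 1)
  have a0 := he k
  have a1 := ho k
  have a2 := he (k + 1)
  have a3 := ho (k + 1)
  have a4 := he (k + 2)
  have a5 := ho (k + 2)
  have a6 := he (k + 3)
  have a7 := ho (k + 3)
  have a8 := he (k + 4)
  simp only [ladderOperator, mul_add, add_assoc, Nat.reduceAdd, Nat.reduceMul, Nat.cast_add,
    Nat.cast_one] at h0 h1 a0 a1 a2 a3 a4 a5 a6 a7 a8
  obtain ⟨c, hc⟩ : ∃ c : Fin 9 → ℚ, ∀ i, c i
      = hornerEval (recurrenceCoeffs i) (2 * k + 2) := ⟨_, fun _ => rfl⟩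
  have hs : 12 * ∑ i : Fin 9, c i * a (2 * k + 2 + i)
      = c 0 * (u (k + 1) - u k)  + c 1 * (u (k + 2) - 8 * u (k + 1) + 7 * u k)
         + c 2 * (u (k + 2) - u (k + 1))  + c 3 * (u (k + 3) - 8 * u (k + 2) + 7 * u (k + 1))
         + c 4 * (u (k + 3) - u (k + 2))  + c 5 * (u (k + 4) - 8 * u (k + 3) + 7 * u (k + 2))
         + c 6 * (u (k + 4) - u (k + 3))  + c 7 * (u (k + 5) - 8 * u (k + 4) + 7 * u (k + 3))
         + c 8 * (u (k + 5) - u (k + 4)) := by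
    simp only [Fin.sum_univ_succ, Finset.univ_eq_empty, Finset.sum_empty, Fin.val_zero, Fin.val_succ,
      add_assoc, Nat.reduceAdd, Fin.reduceSucc, add_zero]
    linear_combination c 0 * a0 + c 1 * a1 + c 2 * a2 + c 3 * a3 + c 4 * a4 + c 5 * a5 + c 6 * a6 + c 7 * a7 + c 8 * a8
  simp only [← hc]
  have hD : (69177612 + 23059204 * k : ℚ) ≠ 0 := by positivity
  refine (mul_eq_zero.1 ((mul_eq_zero.1 ?_).resolve_left hD)).resolve_left
    (show (12 : ℚ) ≠ 0 by norm_num)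
  rw [hs]
  simp only [hc, recurrenceCoeffs, Matrix.cons_val, hornerEval, List.foldr_cons,
    List.foldr_nil]
  linear_combination
      (-4075216151751709315967616 - 38337190178620224235238272 * k -
      138237042693875090551533696 * k ^ 2 - 274896480110060524608256000 * k ^ 3 -
      349597681159609615168106496 * k ^ 4 - 306512490871479564080869376 * k ^ 5 -
      192988644722230667431432192 * k ^ 6 - 89136671799373930744119296 * k ^ 7 -
      30446879524277972645937152 * k ^ 8 - 7670269388304490162126848 * k ^ 9 -
      1405272083125058949513216 * k ^ 10 - 181847720011505868472320 * k ^ 11 -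
      15736466707223056220160 * k ^ 12 - 816457078354697256960 * k ^ 13 -
      19193550481863475200 * k ^ 14) * h0 + (625279977212417760121728 +
      6559821437439845807105664 * k + 27491524036617084574368896 * k ^ 2 +
      64270803873712593953961984 * k ^ 3 + 96057797943665912508026880 * k ^ 4 +
      98539484458788090427494400 * k ^ 5 + 72195509164263112020807680 * k ^ 6 +
      38580289156153589393260544 * k ^ 7 + 15156481870839015036452864 * k ^ 8 +
      4363924375231850420404224 * k ^ 9 + 907688894878708637270016 * k ^ 10 +
      132422368995148046008320 * k ^ 11 + 12827318540258896773120 * k ^ 12 +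
      739682876427243356160 * k ^ 13 + 19193550481863475200 * k ^ 14) * h1

set_option maxRecDepth 10000 in
lemma sum_recurrence_odd (u : ℕ → ℚ) (hu : ∀ m, ladderOperator u m = 0) (a : ℕ → ℚ)
    (he : ∀ m, 12 * a (2 * m + 2) = u (m + 1) - u m)
    (ho : ∀ m, 12 * a (2 * m + 3) = u (m + 2) - 8 * u (m + 1) + 7 * u m) (k : ℕ) :
    ∑ i : Fin 9, hornerEval (recurrenceCoeffs i) (2 * k + 3) * a (2 * k + 3 + i) = 0 := by
  have h0 := hu k
  have h1 := hu (k + 1)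
  have h2 := hu (k + 2)
  have a0 := ho k
  have a1 := he (k + 1)
  have a2 := ho (k + 1)
  have a3 := he (k + 2)
  have a4 := ho (k + 2)
  have a5 := he (k + 3)
  have a6 := ho (k + 3)
  have a7 := he (k + 4)
  have a8 := ho (k + 4)
  simp only [ladderOperator, mul_add, add_assoc, Nat.reduceAdd, Nat.reduceMul, Nat.cast_add,
    Nat.cast_ofNat, Nat.cast_one] at h0 h1 h2 a0 a1 a2 a3 a4 a5 a6 a7 a8
  obtain ⟨c, hc⟩ : ∃ c : Fin 9 → ℚ, ∀ i, c i
      = hornerEval (recurrenceCoeffs i) (2 * k + 3) := ⟨_, fun _ => rfl⟩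
  have hs : 12 * ∑ i : Fin 9, c i * a (2 * k + 3 + i)
      = c 0 * (u (k + 2) - 8 * u (k + 1) + 7 * u k)  + c 1 * (u (k + 2) - u (k + 1))
         + c 2 * (u (k + 3) - 8 * u (k + 2) + 7 * u (k + 1))  + c 3 * (u (k + 3) - u (k + 2))
         + c 4 * (u (k + 4) - 8 * u (k + 3) + 7 * u (k + 2))  + c 5 * (u (k + 4) - u (k + 3))
         + c 6 * (u (k + 5) - 8 * u (k + 4) + 7 * u (k + 3))  + c 7 * (u (k + 5) - u (k + 4))
         + c 8 * (u (k + 6) - 8 * u (k + 5) + 7 * u (k + 4)) := by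
    simp only [Fin.sum_univ_succ, Finset.univ_eq_empty, Finset.sum_empty, Fin.val_zero, Fin.val_succ,
      add_assoc, Nat.reduceAdd, Fin.reduceSucc, add_zero]
    linear_combination c 0 * a0 + c 1 * a1 + c 2 * a2 + c 3 * a3 + c 4 * a4 + c 5 * a5 + c 6 * a6 + c 7 * a7 + c 8 * a8
  simp only [← hc]
  have hD : (4650672499536 + 4041655862692 * k + 1162668124884 * k ^ 2 + 110730297608 * k ^ 3 : ℚ) ≠ 0 := by positivity
  refine (mul_eq_zero.1 ((mul_eq_zero.1 ?_).resolve_left hD)).resolve_left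
    (show (12 : ℚ) ≠ 0 by norm_num)
  rw [hs]
  simp only [hc, recurrenceCoeffs, Matrix.cons_val, hornerEval, List.foldr_cons,
    List.foldr_nil]
  linear_combination
      (67702162910796293459231861637120 + 416375750645876068327272893644800 * k +
      1157475776021775703166117782732800 * k ^ 2 + 1936936534466501310578114746048512 * k ^ 3 +
      2189873894381707821995136157790208 * k ^ 4 + 1777806378360776622263818043918336 * k ^ 5 +
      1074188864388522749616660956129280 * k ^ 6 + 493615007977283573467759839545344 * k ^ 7 +
      174602265484707716289902836477952 * k ^ 8 + 47761359368969199079658136944640 * k ^ 9 +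
      10081278016155654422954830004224 * k ^ 10 + 1626292424129514911650251571200 * k ^ 11 +
      196722090638184998847458770944 * k ^ 12 + 17261279553805918717634150400 * k ^ 13 +
      1036676021318404537319424000 * k ^ 14 + 38089726329121214709104640 * k ^ 15 +
      645172005897358855372800 * k ^ 16) * h0 + (-10955319930513207391279581480960 -
      80416369064123660164024878858240 * k - 265731512341523361672418714476544 * k ^ 2 -
      525037003069163150985788254685184 * k ^ 3 - 695116269205506494874039800465408 * k ^ 4 -
      654958480958619056121541643913216 * k ^ 5 - 455172577962664837369987920799744 * k ^ 6 -
      238464854675367692162168367403008 * k ^ 7 - 95364004970937183093804320833536 * k ^ 8 -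
      29261024972235189235504791158784 * k ^ 9 - 6877279592132777096889327583232 * k ^ 10 -
      1226929243143913011373475954688 * k ^ 11 - 163090546237552488737449967616 * k ^ 12 -
      15632168046626349274040893440 * k ^ 13 - 1019840078087575778938060800 * k ^ 14 -
      40489590634050982206504960 * k ^ 15 - 737339435311267263283200 * k ^ 16) * h1 +
      (168194592808444183040907724800 + 1631777249710954074677863477248 * k +
      6689103026158155284943226613760 * k ^ 2 + 15767117907541144389558194022400 * k ^ 3 +
      24285763276335683419536744486912 * k ^ 4 + 26183727184186568965267732013056 * k ^ 5 +
      20589380282799128100973140385792 * k ^ 6 + 12110815896918690101603069102080 * k ^ 7 +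
      5407954929827441194584892887040 * k ^ 8 + 1845465058710810825762435612672 * k ^ 9 +
      480950044441747319799022845952 * k ^ 10 + 94919191415938095604765065216 * k ^ 11 +
      13931054745007050903028826112 * k ^ 12 + 1471904478821644042213785600 * k ^ 13 +
      105692754109584134929121280 * k ^ 14 + 4611882610863569287249920 * k ^ 15 +
      92167429413908407910400 * k ^ 16) * h2

set_option maxRecDepth 10000 in
lemma sum_recurrence_one (u : ℕ → ℚ) (hu : ∀ m, ladderOperator u m = 0) (u0 : u 0 = 1)
    (u1 : u 1 = 13) (u2 : u 2 = 265) (u3 : u 3 = 7117) (a : ℕ → ℚ)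
    (he : ∀ m, 12 * a (2 * m + 2) = u (m + 1) - u m)
    (ho : ∀ m, 12 * a (2 * m + 3) = u (m + 2) - 8 * u (m + 1) + 7 * u m) :
    ∑ i : Fin 9, hornerEval (recurrenceCoeffs i) 1 * a (1 + i) = 0 := by
  have u4 : u 4 = 225001 := by
    have := hu 0
    simp only [ladderOperator, Nat.reduceAdd, u0, u1, u2, u3] at this
    norm_num at this
    linarith
  have u5 : u 5 = 7855813 := by
    have := hu 1
    simp only [ladderOperator, Nat.reduceAdd, u1, u2, u3, u4] at this
    norm_num at this
    linarith
  have a2 := he 0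
  have a3 := ho 0
  have a4 := he 1
  have a5 := ho 1
  have a6 := he 2
  have a7 := ho 2
  have a8 := he 3
  have a9 := ho 3
  simp only [Nat.reduceMul, Nat.reduceAdd, zero_add, u0, u1, u2, u3, u4, u5]
    at a2 a3 a4 a5 a6 a7 a8 a9
  simp only [Fin.sum_univ_succ, Finset.univ_eq_empty, Finset.sum_empty, Fin.val_zero, Fin.val_succ,
    add_assoc, Nat.reduceAdd, Fin.reduceSucc, add_zero, recurrenceCoeffs,
    Matrix.cons_val, hornerEval, List.foldr_cons, List.foldr_nil]
  norm_num
  linarith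

lemma ladderSum_init :
    ladderSum 0 = 1 ∧ ladderSum 1 = 13 ∧ ladderSum 2 = 265 ∧ ladderSum 3 = 7117 := by
  refine ⟨?_, ?_, ?_, ?_⟩ <;>
    norm_num [ladderSum, ladderCoeff, cubicWalks, honeycomb, Finset.sum_range_succ, Nat.choose,
      Nat.centralBinom]

theorem exists_recurrence (a : ℕ → ℕ)
    (he : ∀ m, 12 * (a (2 * m + 2) : ℚ) = ladderSum (m + 1) - ladderSum m)
    (ho : ∀ m, 12 * (a (2 * m + 3) : ℚ)
      = ladderSum (m + 2) - 8 * ladderSum (m + 1) + 7 * ladderSum m) :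
    ∃ p : Fin 9 → Polynomial ℤ,
      (∀ i, (p i).degree ≤ 18) ∧ p 8 ≠ 0 ∧
      ∀ n : ℕ, 1 ≤ n → ∑ i : Fin 9, (p i).eval (n : ℤ) * (a (n + (i : ℕ)) : ℤ) = 0 := by
  refine ⟨fun i => listPoly (recurrenceCoeffs i), fun i => degree_listPoly_le (n := 18) ?_,
    fun h => ?_, fun n hn => ?_⟩
  · fin_cases i <;> simp [recurrenceCoeffs]
  · replace h : listPoly (recurrenceCoeffs 8) = 0 := h
    have := eval_listPoly (recurrenceCoeffs 8) 0
    rw [h] at this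
    simp [recurrenceCoeffs, hornerEval] at this
  · suffices ∑ i : Fin 9, hornerEval (recurrenceCoeffs i) n * (a (n + i) : ℚ) = 0 by
      rw [← Int.cast_inj (α := ℚ)]
      push_cast [eval_listPoly]
      exact this
    obtain ⟨u0, u1, u2, u3⟩ := ladderSum_init
    obtain rfl | ⟨k, rfl | rfl⟩ : n = 1 ∨ ∃ k, n = 2 * k + 2 ∨ n = 2 * k + 3 := by
      rcases Nat.even_or_odd' n with ⟨k, rfl | rfl⟩
      · exact .inr ⟨k - 1, .inl (by omega)⟩
      · rcases Nat.eq_zero_or_pos k with rfl | hk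
        · exact .inl rfl
        · exact .inr ⟨k - 1, .inr (by omega)⟩
    · rw [Nat.cast_one]
      exact sum_recurrence_one ladderSum ladderSum_recurrence u0 u1 u2 u3 (fun n => a n) he ho
    · push_cast
      exact sum_recurrence_even ladderSum ladderSum_recurrence (fun n => a n) he ho k
    · push_cast
      exact sum_recurrence_odd ladderSum ladderSum_recurrence (fun n => a n) he ho k

end Recurrence

section Symmetry

variable {n : ℕ}

/-- Values are introduced in row-major order. -/
def IsOrdered (A : Fin n × Fin 2 → Fin 4) : Prop :=
  ∀ p : Fin n × Fin 2, 0 < (A p : ℕ) →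
    ∃ q : Fin n × Fin 2,
      ((q.1 : ℕ) < (p.1 : ℕ) ∨ (q.1 = p.1 ∧ (q.2 : ℕ) < (p.2 : ℕ))) ∧ (A q : ℕ) = (A p : ℕ) - 1

/-- The rank of a position in row-major order. -/
def rowMajor (p : Fin n × Fin 2) : ℕ := 2 * p.1 + p.2

lemma rowMajor_lt_iff (p q : Fin n × Fin 2) :
    rowMajor q < rowMajor p ↔
      ((q.1 : ℕ) < (p.1 : ℕ) ∨ (q.1 = p.1 ∧ (q.2 : ℕ) < (p.2 : ℕ))) := by
  rw [rowMajor, rowMajor, Fin.ext_iff]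
  omega

lemma rowMajor_injective : Function.Injective (rowMajor (n := n)) := by
  intro p q h
  rw [rowMajor, rowMajor] at h
  ext <;> omega

/-- The rank of the first occurrence of a value. -/
noncomputable def firstOccurrence (A : Fin n × Fin 2 → Fin 4) (v : Fin 4) : ℕ :=
  sInf (rowMajor '' (A ⁻¹' {v}))

lemma firstOccurrence_le (A : Fin n × Fin 2 → Fin 4) (p : Fin n × Fin 2) :
    firstOccurrence A (A p) ≤ rowMajor p :=
  Nat.sInf_le ⟨p, rfl, rfl⟩

lemma exists_firstOccurrence {A : Fin n × Fin 2 → Fin 4} (hA : Function.Surjective A)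
    (v : Fin 4) : ∃ p, A p = v ∧ rowMajor p = firstOccurrence A v := by
  obtain ⟨p, hp⟩ := hA v
  exact Nat.sInf_mem (s := rowMajor '' (A ⁻¹' {v})) ⟨_, p, hp, rfl⟩

lemma firstOccurrence_injective {A : Fin n × Fin 2 → Fin 4} (hA : Function.Surjective A) :
    Function.Injective (firstOccurrence A) := by
  intro v w h
  obtain ⟨p, rfl, hp⟩ := exists_firstOccurrence hA v
  obtain ⟨q, rfl, hq⟩ := exists_firstOccurrence hA w
  rw [rowMajor_injective (hp.trans (h.trans hq.symm))]

lemma firstOccurrence_comp (A : Fin n × Fin 2 → Fin 4) (σ : Equiv.Perm (Fin 4)) :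
    firstOccurrence (σ ∘ A) = firstOccurrence A ∘ σ.symm := by
  ext v
  rw [firstOccurrence, Function.comp_apply, firstOccurrence]
  congr 2
  ext p
  simp [Equiv.eq_symm_apply]

lemma isOrdered_iff {A : Fin n × Fin 2 → Fin 4} (hA : Function.Surjective A) :
    IsOrdered A ↔ StrictMono (firstOccurrence A) := by
  constructor
  · intro h
    rw [Fin.strictMono_iff_lt_succ]
    intro i
    obtain ⟨p, hp, hp'⟩ := exists_firstOccurrence hA i.succ
    obtain ⟨q, hq, hqp⟩ := h p (by rw [hp]; simp)
    rw [← rowMajor_lt_iff, hp'] at hq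
    have e : A q = i.castSucc := by
      rw [hp] at hqp
      ext
      simpa using hqp
    rw [← e]
    exact (firstOccurrence_le A q).trans_lt hq
  · intro h p hp
    have hw : (A p : ℕ) - 1 < 4 := by omega
    obtain ⟨q, hq, hq'⟩ := exists_firstOccurrence hA ⟨(A p : ℕ) - 1, hw⟩
    refine ⟨q, ?_, by rw [hq]⟩
    rw [← rowMajor_lt_iff, hq']
    refine (h ?_).trans_le (firstOccurrence_le A p)
    rw [Fin.lt_def]
    exact Nat.sub_lt hp one_pos

lemma existsUnique_isOrdered {A : Fin n × Fin 2 → Fin 4} (hA : Function.Surjective A) :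
    ∃! σ : Equiv.Perm (Fin 4), IsOrdered (σ ∘ A) := by
  have hf := firstOccurrence_injective hA
  have key (σ : Equiv.Perm (Fin 4)) :
      IsOrdered (σ ∘ A) ↔ Monotone (firstOccurrence A ∘ σ.symm) := by
    rw [isOrdered_iff (σ.surjective.comp hA), firstOccurrence_comp]
    exact ⟨StrictMono.monotone, fun h => h.strictMono_of_injective (hf.comp σ.symm.injective)⟩
  refine ⟨(Tuple.sort (firstOccurrence A)).symm, ?_, fun σ hσ => ?_⟩
  · exact (key _).2 (Tuple.monotone_sort _)
  · have h := Tuple.unique_monotone ((key σ).1 hσ) (Tuple.monotone_sort (firstOccurrence A))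
    have e : σ.symm = Tuple.sort (firstOccurrence A) := Equiv.ext fun v => hf (congrFun h v)
    rw [← e, Equiv.symm_symm]

lemma isProper_comp (A : Fin n × Fin 2 → Fin 4) (σ : Equiv.Perm (Fin 4)) :
    IsProper (σ ∘ A) ↔ IsProper A := by
  simp [IsProper]

lemma isBalanced_comp (A : Fin n × Fin 2 → Fin 4) (σ : Equiv.Perm (Fin 4)) :
    IsBalanced (σ ∘ A) ↔ IsBalanced A := by
  have h (v : Fin 4) : colourCount (σ ∘ A) v = colourCount A (σ.symm v) := by
    simp [colourCount, Equiv.eq_symm_apply]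
  simp only [IsBalanced, h]
  exact ⟨fun H v w => by simpa using H (σ v) (σ w), fun H v w => H _ _⟩

lemma IsBalanced.surjective {A : Fin n × Fin 2 → Fin 4} (hA : IsBalanced A) (hn : 2 ≤ n) :
    Function.Surjective A := by
  intro v
  by_contra! h
  have hv : colourCount A v = 0 := by simpa [colourCount, Finset.filter_eq_empty_iff] using h
  have hs := sum_colourCount A
  rw [← Finset.add_sum_erase _ _ (Finset.mem_univ v), hv, zero_add] at hs
  have := Finset.sum_le_card_nsmul (Finset.univ.erase v) (colourCount A) 1
    fun w _ => by simpa [hv] using hA w v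
  rw [hs, Finset.card_erase_of_mem (Finset.mem_univ v)] at this
  simp at this
  omega

open Classical in
lemma a199250_eq (n : ℕ) : a199250 n = (Finset.filter (fun A : Fin n × Fin 2 → Fin 4 =>
    (IsProper A ∧ IsBalanced A) ∧ IsOrdered A) Finset.univ).card := by
  rw [← Fintype.card_subtype, ← Nat.card_eq_fintype_card, a199250]
  exact Nat.card_congr (Equiv.subtypeEquivRight fun A =>
    ⟨fun ⟨h₁, h₂, h₃, h₄⟩ => ⟨⟨⟨h₁, h₂⟩, h₃⟩, h₄⟩, fun ⟨⟨⟨h₁, h₂⟩, h₃⟩, h₄⟩ => ⟨h₁, h₂, h₃, h₄⟩⟩)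

lemma balancedCount_eq (hn : 2 ≤ n) : balancedCount n = 24 * a199250 n := by
  classical
  let s := Finset.filter (fun A : Fin n × Fin 2 → Fin 4 => IsProper A ∧ IsBalanced A) Finset.univ
  have h := Finset.sum_card_bipartiteAbove_eq_sum_card_bipartiteBelow (s := s)
    (t := (Finset.univ : Finset (Equiv.Perm (Fin 4)))) fun A (σ : Equiv.Perm (Fin 4)) =>
      IsOrdered (σ ∘ A)
  rw [Finset.sum_congr rfl (g := fun _ => 1), Finset.sum_const, smul_eq_mul, mul_one] at h
  · refine h.trans ?_
    rw [Finset.sum_congr rfl (g := fun _ => a199250 n), Finset.sum_const, smul_eq_mul,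
      Finset.card_univ, Fintype.card_perm, Fintype.card_fin]
    · rfl
    · intro σ _
      rw [a199250_eq, Finset.bipartiteBelow, Finset.filter_filter]
      refine Finset.card_equiv (Equiv.arrowCongr (Equiv.refl _) σ) fun A => ?_
      have e : Equiv.arrowCongr (Equiv.refl _) σ A = σ ∘ A := rfl
      simp only [Finset.mem_filter_univ, e, isProper_comp, isBalanced_comp]
  · intro A hA
    obtain ⟨σ, hσ, hu⟩ := existsUnique_isOrdered
      (((Finset.mem_filter_univ A).1 hA).2.surjective hn)
    rw [Finset.card_eq_one]
    refine ⟨σ, ?_⟩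
    ext τ
    simp only [Finset.mem_bipartiteAbove, Finset.mem_univ, true_and, Finset.mem_singleton]
    exact ⟨hu τ, fun h => h ▸ hσ⟩

lemma a199250_even (m : ℕ) :
    12 * (a199250 (2 * m + 2) : ℚ) = ladderSum (m + 1) - ladderSum m := by
  have h := balancedCount_even m
  rw [balancedCount_eq (by omega)] at h
  push_cast at h
  linarith

lemma a199250_odd (m : ℕ) : 12 * (a199250 (2 * m + 3) : ℚ)
    = ladderSum (m + 2) - 8 * ladderSum (m + 1) + 7 * ladderSum m := by
  have h := balancedCount_odd m
  rw [balancedCount_eq (by omega)] at h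
  push_cast at h
  linarith

end Symmetry

/-- There are polynomials `p₀, …, p₈ ∈ ℤ[x]`, each of degree at most `18` and
with `p₈ ≠ 0`, such that `p₀(n)·a(n) + ⋯ + p₈(n)·a(n+8) = 0` for all `n ≥ 1`;
in particular `a199250` is D-finite. -/
theorem stmt3 :
    ∃ p : Fin 9 → Polynomial ℤ,
      (∀ i, (p i).degree ≤ 18) ∧ p 8 ≠ 0 ∧
      ∀ n : ℕ, 1 ≤ n →
        ∑ i : Fin 9, (p i).eval (n : ℤ) * (a199250 (n + (i : ℕ)) : ℤ) = 0 :=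
  exists_recurrence a199250 a199250_even a199250_odd
end
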